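/- Every holomorphic vector bundle on Z_1 = Tot(O_{P^1}(-1)) restricts to a trivial bundle on the complement Z_1 − ℓ of the zero section ℓ. -/

import Mathlib

/-!  Common setup: the local surfaces `Z_k = Tot 𝒪_{ℙ¹}(-k)`.

`Z_k` is covered by the two canonical coordinate charts `U = ℂ²_{z,u}` and
`V = ℂ²_{ξ,v}`, glued over `ℂ* × ℂ` by `(ξ, v) = (z⁻¹, z^k u)`.  Since every
holomorphic vector bundle on a chart `ℂ²` is trivial (Oka–Grauert), a
holomorphic rank `r` vector bundle on `Z_k` is presented by its transition
matrix in canonical coordinates, and all the numerical invariants (splitting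
type, width `h⁰(Q)`, height `h⁰(R¹π_*E)`, local charge
`c₂^{loc} = χ(ℓ,E) = width + height`) are computed, as in the paper, by Čech
cohomology in canonical coordinates. -/

noncomputable section

open Matrix

/-- The overlap `U ∩ V` of the two canonical charts, in `U`-coordinates:
the locus `z ≠ 0`. -/
def overlap : Set (ℂ × ℂ) := {p | p.1 ≠ 0}

/-- The change of canonical coordinates of `Z_k`: `(z, u) ↦ (ξ, v) = (z⁻¹, z^k u)`. -/
def coordChange (k : ℕ) (p : ℂ × ℂ) : ℂ × ℂ := (p.1⁻¹, p.1 ^ k * p.2)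

/-- A holomorphic rank `r` vector bundle on `Z_k`, presented by its transition
matrix in the canonical coordinates (`U`-frame vs. `V`-frame). -/
structure BundleData (r k : ℕ) where
  T : ℂ × ℂ → Matrix (Fin r) (Fin r) ℂ
  holo : ∀ i j, DifferentiableOn ℂ (fun p => T p i j) overlap
  invertible : ∀ p ∈ overlap, IsUnit (T p)

/-- A holomorphic family of invertible `r × r` matrices on `s ⊆ ℂ²`. -/
def HoloGL (r : ℕ) (s : Set (ℂ × ℂ)) (A : ℂ × ℂ → Matrix (Fin r) (Fin r) ℂ) : Prop :=
  (∀ i j, DifferentiableOn ℂ (fun p => A p i j) s) ∧ ∀ p ∈ s, IsUnit (A p)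

/-- Isomorphism of holomorphic bundles on `Z_k`, in terms of transition
matrices: `T' = A ⬝ T ⬝ B⁻¹` with `A` holomorphic invertible on the chart `U`
and `B` holomorphic invertible on the chart `V`. -/
def BIso {r k : ℕ} (E E' : BundleData r k) : Prop :=
  ∃ A B : ℂ × ℂ → Matrix (Fin r) (Fin r) ℂ,
    HoloGL r Set.univ A ∧ HoloGL r Set.univ B ∧
    ∀ p ∈ overlap, E'.T p = A p * E.T p * (B (coordChange k p))⁻¹

/-- `c₁(E) = 0`:  the determinant line bundle of `E` is holomorphically
trivial, i.e. `det T` is a coboundary of nonvanishing holomorphic functions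
on the two charts. -/
def FirstChernZero {r k : ℕ} (E : BundleData r k) : Prop :=
  ∃ a b : ℂ × ℂ → ℂ, Differentiable ℂ a ∧ Differentiable ℂ b ∧
    (∀ p, a p ≠ 0) ∧ (∀ p, b p ≠ 0) ∧
    ∀ p ∈ overlap, (E.T p).det = a p * b (coordChange k p)

/-- `E` has splitting type `j`:  the restriction `E|_ℓ` to the zero section
`ℓ ≅ ℙ¹` (cut out by `u = 0`) splits as `𝒪_{ℙ¹}(j) ⊕ 𝒪_{ℙ¹}(-j)`, i.e. the
restricted transition matrix `T(z,0)` is equivalent, over the standard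
two-chart cover of `ℙ¹`, to `diag(z^j, z^{-j})`. -/
def SplittingType {k : ℕ} (E : BundleData 2 k) (j : ℕ) : Prop :=
  ∃ A B : ℂ → Matrix (Fin 2) (Fin 2) ℂ,
    (∀ i l, Differentiable ℂ fun z => A z i l) ∧
    (∀ i l, Differentiable ℂ fun z => B z i l) ∧
    (∀ z, IsUnit (A z)) ∧ (∀ z, IsUnit (B z)) ∧
    ∀ z : ℂ, z ≠ 0 → E.T (z, 0) = A z * !![z ^ j, 0; 0, (z ^ j)⁻¹] * (B z⁻¹)⁻¹

/-- Holomorphic `ℂ^r`-valued maps on a subset `s ⊆ ℂ²`. -/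
def HoloVec (r : ℕ) (s : Set (ℂ × ℂ)) (f : ℂ × ℂ → Fin r → ℂ) : Prop :=
  ∀ i, DifferentiableOn ℂ (fun p => f p i) s

/-- Čech 1-cochains for `E` on the cover `{U, V}`: sections of `E` over
`U ∩ V`, written in the `U`-frame. -/
def cochains (r : ℕ) : Set ((ℂ × ℂ) → (Fin r → ℂ)) := {f | HoloVec r overlap f}

/-- Čech coboundaries: sums `a + T ⬝ (b ∘ coordChange)` of a holomorphic
section over `U` and one over `V`. -/
def coboundaries {r k : ℕ} (E : BundleData r k) : Set ((ℂ × ℂ) → (Fin r → ℂ)) :=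
  {f | ∃ a b, HoloVec r Set.univ a ∧ HoloVec r Set.univ b ∧
      ∀ p ∈ overlap, f p = a p + (E.T p).mulVec (b (coordChange k p))}

/-- The *height* `h⁰(R¹π_* E)` of `E`, where `π : Z_k → X_k` contracts `ℓ`:
by the theorem on formal functions it is computed as the dimension of the
Čech cohomology `H¹(Z_k, E)` in canonical coordinates (the sets of cochains
and coboundaries are `ℂ`-subspaces, so taking spans changes nothing). -/
def height {r k : ℕ} (E : BundleData r k) : ℕ :=
  Module.finrank ℂ
    (↥(Submodule.span ℂ (cochains r)) ⧸
      (Submodule.comap (Submodule.span ℂ (cochains r)).subtype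
        (Submodule.span ℂ (coboundaries E))))

/-- Sections of `E` over `Z_k ∖ ℓ`, in the `U`-frame: holomorphic on
`U ∖ ℓ = {u ≠ 0}` and matching a holomorphic section on `V ∖ ℓ = {v ≠ 0}`
via the transition matrix.  These are the sections of the reflexive hull
`(π_* E)^{∨∨} ` over `X_k`. -/
def outerSections {r k : ℕ} (E : BundleData r k) : Set ((ℂ × ℂ) → (Fin r → ℂ)) :=
  {f | HoloVec r {p | p.2 ≠ 0} f ∧ ∃ b, HoloVec r {p | p.2 ≠ 0} b ∧
      ∀ p : ℂ × ℂ, p.1 ≠ 0 → p.2 ≠ 0 → f p = (E.T p).mulVec (b (coordChange k p))}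

/-- Global sections of `E` over `Z_k`, i.e. sections of `π_* E`, in the
`U`-frame. -/
def globalSections {r k : ℕ} (E : BundleData r k) : Set ((ℂ × ℂ) → (Fin r → ℂ)) :=
  {f | HoloVec r Set.univ f ∧ ∃ b, HoloVec r Set.univ b ∧
      ∀ p ∈ overlap, f p = (E.T p).mulVec (b (coordChange k p))}

/-- The *width* `h⁰(Q)` of `E`, where `Q` is the skyscraper sheaf in
`0 → π_*E → (π_*E)^{∨∨} → Q → 0`:  the dimension of
`Γ(Z_k ∖ ℓ, E) / Γ(Z_k, E)`. -/
def width {r k : ℕ} (E : BundleData r k) : ℕ :=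
  Module.finrank ℂ
    (↥(Submodule.span ℂ (outerSections E)) ⧸
      (Submodule.comap (Submodule.span ℂ (outerSections E)).subtype
        (Submodule.span ℂ (globalSections E))))

/-- The local charge (local second Chern class `c₂^{loc}`, equal to the local
holomorphic Euler characteristic `χ(ℓ, E) = h⁰(Q) + h⁰(R¹π_*E)`) of `E`
around the zero section `ℓ ⊆ Z_k`. -/
def localCharge {r k : ℕ} (E : BundleData r k) : ℕ := width E + height E

/-- The transition matrix `[[z^j, p],[0, z^{-j}]]` of the extension
`0 → 𝒪(-j) → E → 𝒪(j) → 0` with extension class `p ∈ Ext¹(𝒪(j), 𝒪(-j))`. -/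
def extMatrix (j : ℕ) (p : ℂ × ℂ → ℂ) (q : ℂ × ℂ) : Matrix (Fin 2) (Fin 2) ℂ :=
  !![q.1 ^ j, p q; 0, (q.1 ^ j)⁻¹]

/-- The rank 2 bundle on `Z_k` with `c₁ = 0`, splitting type `j` and extension
class `p`, given in canonical coordinates by the transition matrix
`[[z^j, p],[0, z^{-j}]]`. -/
def extBundle (k j : ℕ) (p : ℂ × ℂ → ℂ) (hp : DifferentiableOn ℂ p overlap) :
    BundleData 2 k where
  T := extMatrix j p
  holo := by
    intro i l
    fin_cases i <;> fin_cases l <;>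
      simp only [extMatrix, Matrix.cons_val', Matrix.cons_val_zero, Matrix.cons_val_one,
        Matrix.head_cons, Matrix.empty_val', Matrix.cons_val_fin_one, Matrix.head_fin_const,
        Matrix.of_apply, Fin.isValue]
    · exact (differentiable_fst.pow j).differentiableOn
    · exact hp
    · exact differentiableOn_const 0
    · exact DifferentiableOn.inv ((differentiable_fst.pow j).differentiableOn)
        (fun q hq => pow_ne_zero j hq)
  invertible := by
    intro q hq
    rw [Matrix.isUnit_iff_isUnit_det]
    have hdet : (extMatrix j p q).det = 1 := by
      have hq1 : q.1 ≠ 0 := hq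
      simp [extMatrix, Matrix.det_fin_two_of, mul_inv_cancel₀ (pow_ne_zero j hq1)]
    rw [hdet]; exact isUnit_one


section PuncturedTriviality

open Set Filter Topology Metric

section Analysis
variable {E G : Type*} [NormedAddCommGroup E] [NormedSpace ℂ E] [NormedAddCommGroup G]
  [NormedSpace ℂ G]

lemma norm_fderiv_le_of_bound {f : E → G} {x : E} {ρ M : ℝ} (hρ : 0 < ρ)
    (hf : DifferentiableOn ℂ f (ball x ρ)) (hM : ∀ y ∈ ball x ρ, ‖f y‖ ≤ M) :
    ‖fderiv ℂ f x‖ ≤ 2 * M / ρ := by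
  refine Complex.norm_fderiv_le_div_of_mapsTo_ball hf (fun y hy => ?_) hρ
  rw [mem_closedBall, dist_eq_norm]
  linarith [norm_sub_le (f y) (f x), hM y hy, hM x (mem_ball_self hρ)]

lemma norm_fderiv_le_of_bound' {f : E → G} {x y : E} {ρ M : ℝ} (hρ : 0 < ρ)
    (hf : DifferentiableOn ℂ f (ball x (2 * ρ))) (hM : ∀ y ∈ ball x (2 * ρ), ‖f y‖ ≤ M)
    (hy : y ∈ ball x ρ) : ‖fderiv ℂ f y‖ ≤ 2 * M / ρ := by
  have hsub : ball y ρ ⊆ ball x (2 * ρ) := ball_subset_ball' (by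
    rw [mem_ball] at hy; linarith)
  exact norm_fderiv_le_of_bound hρ (hf.mono hsub) fun z hz => hM z (hsub hz)

lemma differentiableOn_of_tendstoUniformlyOn [CompleteSpace G] {f : ℕ → E → G} {F : E → G}
    {s : Set E} (hs : IsOpen s) (hf : ∀ n, DifferentiableOn ℂ (f n) s)
    (hF : TendstoUniformlyOn f F atTop s) : DifferentiableOn ℂ F s := by
  intro x hx
  obtain ⟨ρ, hρ, hsub⟩ : ∃ ρ > 0, ball x (2 * ρ) ⊆ s := by
    obtain ⟨ε, hε, h⟩ := Metric.isOpen_iff.1 hs x hx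
    exact ⟨ε / 2, by positivity, by rwa [mul_div_cancel₀ _ two_ne_zero]⟩
  have hsub' : ball x ρ ⊆ s := (ball_subset_ball (by linarith)).trans hsub
  have hcauchy : UniformCauchySeqOn (fun n => fderiv ℂ (f n)) atTop (ball x ρ) := by
    rw [Metric.uniformCauchySeqOn_iff]
    intro ε hε
    obtain ⟨N, hN⟩ := Metric.uniformCauchySeqOn_iff.1 hF.uniformCauchySeqOn (ε * ρ / 4)
      (by positivity)
    refine ⟨N, fun m hm n hn y hy => ?_⟩
    have hd : ∀ k, DifferentiableAt ℂ (f k) y := fun k =>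
      (hf k).differentiableAt (hs.mem_nhds (hsub' hy))
    rw [dist_eq_norm, ← fderiv_sub (hd m) (hd n)]
    have := norm_fderiv_le_of_bound' (f := f m - f n) (M := ε * ρ / 4) hρ
      (((hf m).sub (hf n)).mono hsub)
      (fun z hz => by
        have := hN m hm n hn z (hsub hz)
        rw [dist_eq_norm] at this
        exact this.le) hy
    refine this.trans_lt ?_
    rw [show 2 * (ε * ρ / 4) / ρ = ε / 2 by field_simp; norm_num]
    linarith
  have hlim : ∀ y ∈ ball x ρ, ∃ L, Tendsto (fun n => fderiv ℂ (f n) y) atTop (𝓝 L) :=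
    fun y hy => cauchySeq_tendsto_of_complete (hcauchy.cauchySeq hy)
  choose! L hL using hlim
  have hun := hcauchy.tendstoUniformlyOn_of_tendsto hL
  exact (hasFDerivAt_of_tendstoUniformlyOn isOpen_ball hun
    (fun n y hy => ((hf n).differentiableAt (hs.mem_nhds (hsub' hy))).hasFDerivAt)
    (fun y hy => hF.tendsto_at (hsub' hy))
    (mem_ball_self hρ)).differentiableAt.differentiableWithinAt

lemma differentiableOn_tsum_of_norm_le [CompleteSpace G] {f : ℕ → E → G} {u : ℕ → ℝ}
    {s : Set E} (hs : IsOpen s) (hf : ∀ n, DifferentiableOn ℂ (f n) s) (hu : Summable u)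
    (hfu : ∀ n, ∀ x ∈ s, ‖f n x‖ ≤ u n) : DifferentiableOn ℂ (fun x => ∑' n, f n x) s :=
  differentiableOn_of_tendstoUniformlyOn hs
    (fun _ => DifferentiableOn.fun_sum fun n _ => hf n) (tendstoUniformlyOn_tsum_nat hu hfu)

open MeasureTheory in
lemma differentiableOn_intervalIntegral
    [ProperSpace E] [CompleteSpace G] {F : ℝ → E → G} {s : Set E}
    (a b : ℝ) (hs : IsOpen s) (hc : ContinuousOn (Function.uncurry F) (univ ×ˢ s))
    (hF : ∀ t, DifferentiableOn ℂ (F t) s) :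
    DifferentiableOn ℂ (fun p => ∫ t in a..b, F t p) s := by
  intro x hx
  obtain ⟨ρ, hρ, hsub⟩ : ∃ ρ > 0, closedBall x (2 * ρ) ⊆ s := by
    obtain ⟨ε, hε, h⟩ := Metric.nhds_basis_closedBall.mem_iff.1 (hs.mem_nhds hx)
    exact ⟨ε / 2, by positivity, by rwa [mul_div_cancel₀ _ two_ne_zero]⟩
  have hbs : ball x (2 * ρ) ⊆ s := ball_subset_closedBall.trans hsub
  have hbs' : ball x ρ ⊆ s := (ball_subset_ball (by linarith)).trans hbs
  have hcK : ContinuousOn (Function.uncurry F) (uIcc a b ×ˢ closedBall x (2 * ρ)) :=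
    hc.mono (prod_mono (subset_univ _) hsub)
  obtain ⟨M, hM⟩ := (isCompact_uIcc.prod
    (isCompact_closedBall x (2 * ρ))).exists_bound_of_continuousOn
    hcK
  have hslice : ∀ p ∈ s, Continuous fun t => F t p := fun p hp => by
    rw [← continuousOn_univ]
    exact hc.comp (f := fun t => (t, p)) (by fun_prop) (fun t _ => ⟨mem_univ _, hp⟩)
  have hfd : Continuous fun t => fderiv ℂ (F t) x := by
    rw [Metric.continuous_iff']
    intro t ε hε
    obtain ⟨v, hv, hv'⟩ := (isCompact_closedBall x (2 * ρ)).mem_uniformity_of_prod (f := F)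
      (s := univ) (q := t) (u := {p | dist p.1 p.2 < ε * ρ / 4})
      (hc.mono (prod_mono le_rfl hsub)) (mem_univ _) (Metric.dist_mem_uniformity (by positivity))
    rw [nhdsWithin_univ] at hv
    filter_upwards [hv] with t' ht'
    have hd : ∀ k, DifferentiableAt ℂ (F k) x := fun k =>
      (hF k).differentiableAt (hs.mem_nhds hx)
    rw [dist_eq_norm, ← fderiv_sub (hd _) (hd _)]
    have := norm_fderiv_le_of_bound' (f := F t' - F t) (M := ε * ρ / 4) hρ
      (((hF _).sub (hF _)).mono hbs)
      (fun z hz => by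
        have := hv' t' ht' z (ball_subset_closedBall hz)
        rw [mem_ofPred_eq, dist_eq_norm] at this
        exact this.le) (mem_ball_self hρ)
    refine this.trans_lt ?_
    rw [show 2 * (ε * ρ / 4) / ρ = ε / 2 by field_simp; norm_num]
    linarith
  have key := intervalIntegral.hasFDerivAt_integral_of_dominated_loc_of_lip (𝕜 := ℂ)
    (F := fun p t => F t p) (F' := fun t => fderiv ℂ (F t) x) (x₀ := x) (a := a) (b := b)
    (μ := volume) (s := ball x ρ) (bound := fun _ => 2 * M / ρ) (ball_mem_nhds x hρ)
    (by
      filter_upwards [hs.mem_nhds hx] with p hp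
      exact (hslice p hp).aestronglyMeasurable)
    ((hslice x hx).intervalIntegrable _ _) hfd.aestronglyMeasurable
    (Eventually.of_forall fun t ht => by
      refine (convex_ball x ρ).lipschitzOnWith_of_nnnorm_fderiv_le (𝕜 := ℂ) (fun y hy =>
        (hF t).differentiableAt
        (hs.mem_nhds (hbs' hy))) fun y hy => ?_
      rw [← NNReal.coe_le_coe, coe_nnnorm, Real.coe_nnabs]
      refine (norm_fderiv_le_of_bound' (M := M) hρ ((hF t).mono hbs) (fun z hz => ?_) hy).trans
        (le_abs_self _)
      exact hM (t, z) ⟨uIoc_subset_uIcc ht, ball_subset_closedBall hz⟩)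
    (intervalIntegrable_const)
    (Eventually.of_forall fun t _ => ((hF t).differentiableAt (hs.mem_nhds hx)).hasFDerivAt)
  exact key.2.differentiableAt.differentiableWithinAt

lemma differentiableOn_circleIntegral [ProperSpace E] [CompleteSpace G] {F : ℂ → E → G} {s : Set E}
    {c : ℂ} {R : ℝ} (hR : 0 ≤ R) (hs : IsOpen s)
    (hc : ContinuousOn (Function.uncurry F) (sphere c R ×ˢ s))
    (hF : ∀ w ∈ sphere c R, DifferentiableOn ℂ (F w) s) :
    DifferentiableOn ℂ (fun p => ∮ w in C(c, R), F w p) s := by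
  unfold circleIntegral
  refine differentiableOn_intervalIntegral _ _ hs ?_ fun t =>
    (hF _ (circleMap_mem_sphere c hR t)).const_smul _
  have h1 : Continuous fun t : ℝ => deriv (circleMap c R) t := by
    simp only [deriv_circleMap]; fun_prop
  have h2 : ContinuousOn (fun q : ℝ × E => (circleMap c R q.1, q.2)) (univ ×ˢ s) := by fun_prop
  exact (h1.comp continuous_fst).continuousOn.smul
    (hc.comp h2 fun q hq => ⟨circleMap_mem_sphere c hR q.1, hq.2⟩)

lemma exists_glue {f g : E → G} {s t : Set E} (hs : IsOpen s) (ht : IsOpen t)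
    (hf : DifferentiableOn ℂ f s) (hg : DifferentiableOn ℂ g t) (hfg : EqOn f g (s ∩ t)) :
    ∃ h, DifferentiableOn ℂ h (s ∪ t) ∧ EqOn h f s ∧ EqOn h g t := by
  classical
  have h1 : EqOn (s.piecewise f g) f s := fun x hx => by simp [hx]
  have h2 : EqOn (s.piecewise f g) g t := fun x hx => by
    by_cases h : x ∈ s
    · simp [h, hfg ⟨h, hx⟩]
    · simp [h]
  exact ⟨_, (hf.congr h1).union_of_isOpen (hg.congr h2) hs ht, h1, h2⟩

end Analysis

section HoloUnits
variable {E R : Type*} [NormedAddCommGroup E] [NormedSpace ℂ E] [NormedRing R] [NormedAlgebra ℂ R]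

/-- A holomorphic map from a subset of `E` to the units of a Banach algebra. -/
def HoloUnits (F : E → R) (s : Set E) : Prop := DifferentiableOn ℂ F s ∧ ∀ p ∈ s, IsUnit (F p)

namespace HoloUnits
variable {F F' : E → R} {s t : Set E}

lemma mono (h : HoloUnits F s) (hst : t ⊆ s) : HoloUnits F t :=
  ⟨h.1.mono hst, fun p hp => h.2 p (hst hp)⟩

lemma congr (h : HoloUnits F s) (hst : EqOn F' F s) : HoloUnits F' s :=
  ⟨h.1.congr hst, fun _ hp => hst hp ▸ h.2 _ hp⟩

lemma mul (h : HoloUnits F s) (h' : HoloUnits F' s) : HoloUnits (fun p => F p * F' p) s :=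
  ⟨h.1.mul h'.1, fun p hp => (h.2 p hp).mul (h'.2 p hp)⟩

lemma inv [CompleteSpace R] (h : HoloUnits F s) : HoloUnits (fun p => Ring.inverse (F p)) s := by
  refine ⟨fun p hp => ?_, fun p hp => (h.2 p hp).ringInverse⟩
  exact (differentiableAt_inverse (𝕜 := ℂ) (h.2 p hp)).comp_differentiableWithinAt p (h.1 p hp)

lemma const {a : R} (ha : IsUnit a) : HoloUnits (fun _ : E => a) s :=
  ⟨differentiableOn_const _, fun _ _ => ha⟩

lemma comp {E' : Type*} [NormedAddCommGroup E'] [NormedSpace ℂ E'] {φ : E' → E} {t : Set E'}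
    (h : HoloUnits F s) (hφ : DifferentiableOn ℂ φ t) (hm : MapsTo φ t s) :
    HoloUnits (fun p => F (φ p)) t :=
  ⟨h.1.comp hφ hm, fun _ hp => h.2 _ (hm hp)⟩

lemma exists_glue (h : HoloUnits F s) (h' : HoloUnits F' t) (hs : IsOpen s) (ht : IsOpen t)
    (heq : EqOn F F' (s ∩ t)) : ∃ H : E → R, HoloUnits H (s ∪ t) ∧ EqOn H F s ∧ EqOn H F' t := by
  obtain ⟨H, h1, h2, h3⟩ := _root_.exists_glue hs ht h.1 h'.1 heq
  refine ⟨H, ⟨h1, fun p hp => ?_⟩, h2, h3⟩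
  rcases hp with hp | hp
  · rw [h2 hp]; exact h.2 p hp
  · rw [h3 hp]; exact h'.2 p hp

end HoloUnits

lemma HoloUnits.of_locally {F : E → R} {s : Set E}
    (h : ∀ p ∈ s, ∃ t, IsOpen t ∧ p ∈ t ∧ HoloUnits F t) : HoloUnits F s := by
  refine ⟨fun p hp => ?_, fun p hp => ?_⟩ <;> obtain ⟨t, ht, hpt, hF⟩ := h p hp
  · exact (hF.1.differentiableAt (ht.mem_nhds hpt)).differentiableWithinAt
  · exact hF.2 p hpt

lemma isUnit_of_norm_sub_one_lt {R : Type*} [NormedRing R] [CompleteSpace R] {x : R}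
    (h : ‖x - 1‖ < 1) : IsUnit x := by
  have := isUnit_one_sub_of_norm_lt_one (x := 1 - x) (by rwa [norm_sub_rev])
  rwa [sub_sub_cancel] at this

end HoloUnits

section Laurent
variable {G : Type*} [NormedAddCommGroup G] [NormedSpace ℂ G] [CompleteSpace G]

/-- The product of an open annulus centred at `0` and a set. -/
def annProd (r₁ r₂ : ℝ) (D : Set ℂ) : Set (ℂ × ℂ) := {p | r₁ < ‖p.1‖ ∧ ‖p.1‖ < r₂ ∧ p.2 ∈ D}

/-- The product of an open disc centred at `0` and a set. -/
def discProd (r : ℝ) (D : Set ℂ) : Set (ℂ × ℂ) := {p | ‖p.1‖ < r ∧ p.2 ∈ D}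

/-- The involution `(z, u) ↦ (z⁻¹, u)`. -/
def invFst (p : ℂ × ℂ) : ℂ × ℂ := (p.1⁻¹, p.2)

lemma invFst_invFst (p : ℂ × ℂ) : invFst (invFst p) = p := by simp [invFst]

lemma isOpen_annProd {r₁ r₂ : ℝ} {D : Set ℂ} (hD : IsOpen D) : IsOpen (annProd r₁ r₂ D) :=
  (isOpen_lt continuous_const continuous_fst.norm).inter
    ((isOpen_lt continuous_fst.norm continuous_const).inter (hD.preimage continuous_snd))

lemma isOpen_discProd {r : ℝ} {D : Set ℂ} (hD : IsOpen D) : IsOpen (discProd r D) :=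
  (isOpen_lt continuous_fst.norm continuous_const).inter (hD.preimage continuous_snd)

lemma differentiableOn_invFst {s : Set (ℂ × ℂ)} (hs : ∀ p ∈ s, p.1 ≠ 0) :
    DifferentiableOn ℂ invFst s :=
  (differentiableOn_fst.inv hs).prodMk differentiableOn_snd

lemma invFst_mem_annProd {r₁ r₂ : ℝ} (h1 : 0 < r₁) (h2 : 0 < r₂) {D : Set ℂ} {p : ℂ × ℂ} :
    invFst p ∈ annProd r₂⁻¹ r₁⁻¹ D ↔ p ∈ annProd r₁ r₂ D := by
  by_cases hp : p.1 = 0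
  · simp [annProd, invFst, hp, h1.not_gt, h2.le]
  · have : 0 < ‖p.1‖ := norm_pos_iff.2 hp
    simp only [annProd, invFst, mem_ofPred_eq, norm_inv]
    rw [inv_lt_inv₀ h2 this, inv_lt_inv₀ this h1]
    tauto

lemma cauchy_annulus {f : ℂ → G} {ρ₁ ρ₂ : ℝ} (h1 : 0 < ρ₁) {U : Set ℂ} (hU : IsOpen U)
    (hUA : ∀ z, ρ₁ ≤ ‖z‖ → ‖z‖ ≤ ρ₂ → z ∈ U)
    (hf : DifferentiableOn ℂ f U) {z : ℂ} (hz1 : ρ₁ < ‖z‖) (hz2 : ‖z‖ < ρ₂) :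
    f z = (2 * Real.pi * Complex.I : ℂ)⁻¹ • (∮ w in C(0, ρ₂), (w - z)⁻¹ • f w)
      - (2 * Real.pi * Complex.I : ℂ)⁻¹ • (∮ w in C(0, ρ₁), (w - z)⁻¹ • f w) := by
  have hzU : U ∈ 𝓝 z := hU.mem_nhds (hUA z hz1.le hz2.le)
  have hd : DifferentiableOn ℂ (dslope f z) U := (Complex.differentiableOn_dslope hzU).2 hf
  have key := Complex.circleIntegral_eq_of_differentiable_on_annulus_off_countable (c := 0) h1
    (hz1.trans hz2).le (f := dslope f z) (s := ∅) countable_empty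
    (hd.continuousOn.mono fun w hw => hUA w (by simpa using hw.2) (by simpa using hw.1))
    (fun w hw => hd.differentiableAt (hU.mem_nhds (hUA w
      (by have := hw.1.2; simp at this; exact this.le)
      (by have := hw.1.1; simp at this; exact this.le))))
  have hρ2 : 0 < ρ₂ := h1.trans (hz1.trans hz2)
  have expand : ∀ ρ : ℝ, 0 < ρ → ρ₁ ≤ ρ → ρ ≤ ρ₂ → ‖z‖ ≠ ρ →
      (∮ w in C(0, ρ), dslope f z w) = (∮ w in C(0, ρ), (w - z)⁻¹ • f w) -
        (∮ w in C(0, ρ), (w - z)⁻¹) • f z := by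
    intro ρ hρ ha hb hne
    have hns : ∀ w ∈ sphere (0 : ℂ) ρ, w - z ≠ 0 := fun w hw h => hne (by
      rw [← sub_eq_zero.1 h]; simpa using hw)
    have hcont : ContinuousOn (fun w => (w - z)⁻¹) (sphere (0 : ℂ) ρ) :=
      ContinuousOn.inv₀ (by fun_prop) hns
    have hfc : ContinuousOn f (sphere (0 : ℂ) ρ) := hf.continuousOn.mono fun w hw => by
      have : ‖w‖ = ρ := by simpa using hw
      exact hUA w (by linarith) (by linarith)
    rw [← circleIntegral.integral_smul_const, ← circleIntegral.integral_sub]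
    · refine circleIntegral.integral_congr hρ.le fun w hw => ?_
      rw [dslope_of_ne _ (sub_ne_zero.1 (hns w hw)), slope_def_module, smul_sub]
    · exact (hcont.smul hfc).circleIntegrable hρ.le
    · exact (hcont.smul continuousOn_const).circleIntegrable hρ.le
  rw [expand ρ₂ hρ2 (by linarith) le_rfl hz2.ne, expand ρ₁ h1 le_rfl (by linarith) hz1.ne',
    circleIntegral.integral_sub_inv_of_mem_ball (by simpa using hz2)] at key
  have h0 : (∮ w in C(0, ρ₁), (w - z)⁻¹) = 0 := by
    refine DiffContOnCl.circleIntegral_eq_zero h1.le (DifferentiableOn.diffContOnCl ?_)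
    intro w hw
    rw [closure_ball _ h1.ne'] at hw
    refine DifferentiableWithinAt.inv (by fun_prop) (fun h => ?_)
    rw [sub_eq_zero.1 h] at hw
    simp at hw; linarith
  rw [h0, zero_smul, sub_zero] at key
  rw [← smul_sub, ← key, sub_sub_cancel, smul_smul, inv_mul_cancel₀ Complex.two_pi_I_ne_zero,
    one_smul]

lemma exists_laurent_split {r₁ r₂ : ℝ} (h1 : 0 < r₁) (h12 : r₁ < r₂) :
    ∃ C : ℝ, 0 < C ∧ ∀ (D : Set ℂ), IsOpen D → ∀ f : ℂ × ℂ → G,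
      DifferentiableOn ℂ f (annProd r₁ r₂ D) → ∃ fp fm : ℂ × ℂ → G,
        DifferentiableOn ℂ fp (discProd r₂ D) ∧ DifferentiableOn ℂ fm (discProd r₁⁻¹ D) ∧
        (∀ p ∈ annProd r₁ r₂ D, f p = fp p + fm (invFst p)) ∧
        ∀ M, (∀ p ∈ annProd r₁ r₂ D, ‖f p‖ ≤ M) →
          (∀ p ∈ discProd r₂ D, ‖fp p‖ ≤ C * M) ∧ ∀ p ∈ discProd r₁⁻¹ D, ‖fm p‖ ≤ C * M := by
  obtain ⟨ρ, hρ1, hρ2⟩ := exists_between h12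
  obtain ⟨a, ha1, haρ⟩ := exists_between hρ1
  obtain ⟨b, hρb, hb2⟩ := exists_between hρ2
  have ha : 0 < a := h1.trans ha1
  have hρ : 0 < ρ := ha.trans haρ
  have hb : 0 < b := hρ.trans hρb
  have hr2 : 0 < r₂ := h1.trans h12
  refine ⟨1 + b / (b - ρ) + a / (ρ - a), by
    have : 0 < b - ρ := by linarith
    have : 0 < ρ - a := by linarith
    positivity, fun D hD f hf => ?_⟩
  set I2 : ℂ × ℂ → G := fun p =>
    (2 * Real.pi * Complex.I : ℂ)⁻¹ • (∮ w in C(0, b), (w - p.1)⁻¹ • f (w, p.2)) with hI2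
  set I1 : ℂ × ℂ → G := fun p =>
    (2 * Real.pi * Complex.I : ℂ)⁻¹ • (∮ w in C(0, a), (p.1 / (1 - w * p.1)) • f (w, p.2)) with hI1
  have dI2 : DifferentiableOn ℂ I2 (discProd b D) := by
    refine DifferentiableOn.const_smul (differentiableOn_circleIntegral
      (F := fun w (p : ℂ × ℂ) => (w - p.1)⁻¹ • f (w, p.2)) hb.le (isOpen_discProd hD) ?_ ?_) _
    · refine ContinuousOn.smul (ContinuousOn.inv₀ (by fun_prop) ?_) ?_
      · rintro ⟨w, p⟩ ⟨hw, hp⟩ h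
        have hw' : ‖w‖ = b := by simpa using hw
        have h' : w = p.1 := sub_eq_zero.1 h
        rw [h'] at hw'
        exact hp.1.ne hw'
      · refine hf.continuousOn.comp (f := fun q : ℂ × (ℂ × ℂ) => (q.1, q.2.2)) (by fun_prop) ?_
        rintro ⟨w, p⟩ ⟨hw, hp⟩
        have : ‖w‖ = b := by simpa using hw
        exact ⟨by simp only; linarith, by simp only; linarith, hp.2⟩
    · intro w hw
      have hw' : ‖w‖ = b := by simpa using hw
      refine DifferentiableOn.smul (DifferentiableOn.inv (by fun_prop) ?_) ?_
      · rintro p hp h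
        rw [sub_eq_zero.1 h] at hw'
        exact hp.1.ne hw'
      · refine hf.comp (f := fun q : ℂ × ℂ => (w, q.2)) (by fun_prop) ?_
        rintro p hp
        exact ⟨by simp only; linarith, by simp only; linarith, hp.2⟩
  have hne1 : ∀ w : ℂ, ‖w‖ = a → ∀ x : ℂ, ‖x‖ < a⁻¹ → 1 - w * x ≠ 0 := fun w hw x hx h => by
    have : ‖w * x‖ = 1 := by rw [← sub_eq_zero.1 h]; simp
    rw [norm_mul, hw] at this
    have h3 := mul_lt_mul_of_pos_left hx ha
    rw [this, mul_inv_cancel₀ ha.ne'] at h3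
    exact lt_irrefl _ h3
  have dI1 : DifferentiableOn ℂ I1 (discProd a⁻¹ D) := by
    refine DifferentiableOn.const_smul (differentiableOn_circleIntegral
      (F := fun w (p : ℂ × ℂ) => (p.1 / (1 - w * p.1)) • f (w, p.2)) ha.le
        (isOpen_discProd hD) ?_ ?_) _
    · refine ContinuousOn.smul (ContinuousOn.div (by fun_prop) (by fun_prop) ?_) ?_
      · rintro ⟨w, p⟩ ⟨hw, hp⟩
        exact hne1 w (by simpa using hw) _ hp.1
      · refine hf.continuousOn.comp (f := fun q : ℂ × (ℂ × ℂ) => (q.1, q.2.2)) (by fun_prop) ?_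
        rintro ⟨w, p⟩ ⟨hw, hp⟩
        have : ‖w‖ = a := by simpa using hw
        exact ⟨by simp only; linarith, by simp only; linarith, hp.2⟩
    · intro w hw
      have hw' : ‖w‖ = a := by simpa using hw
      have hk : DifferentiableOn ℂ (fun p : ℂ × ℂ => p.1 / (1 - w * p.1)) (discProd a⁻¹ D) := by
        simp only [div_eq_mul_inv]
        exact differentiableOn_fst.mul
          (DifferentiableOn.inv (by fun_prop) fun p hp => hne1 w hw' _ hp.1)
      refine hk.smul ?_
      · refine hf.comp (f := fun q : ℂ × ℂ => (w, q.2)) (by fun_prop) ?_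
        rintro p hp
        exact ⟨by simp only; linarith, by simp only; linarith, hp.2⟩
  have hsum : ∀ p ∈ annProd a b D, f p = I2 p + I1 (invFst p) := by
    rintro ⟨z, u⟩ ⟨hz1, hz2, hu⟩
    have hz0 : z ≠ 0 := norm_pos_iff.1 (ha.trans hz1)
    have hsl : DifferentiableOn ℂ (fun w => f (w, u)) {w | r₁ < ‖w‖ ∧ ‖w‖ < r₂} :=
      hf.comp (f := fun w : ℂ => (w, u)) (by fun_prop) fun w hw => ⟨hw.1, hw.2, hu⟩
    have := cauchy_annulus ha (((isOpen_lt continuous_const continuous_norm).inter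
      (isOpen_lt continuous_norm continuous_const))) (fun w h h' => ⟨ha1.trans_le h,
        h'.trans_lt hb2⟩)
      hsl hz1 hz2
    simp only at this
    rw [this, sub_eq_add_neg]
    congr 1
    simp only [hI1, invFst]
    rw [← smul_neg]
    congr 1
    rw [← neg_one_smul ℂ, ← circleIntegral.integral_smul]
    refine circleIntegral.integral_congr ha.le fun w hw => ?_
    have hw' : ‖w‖ = a := by simpa using hw
    have hzw : w - z ≠ 0 := fun h => by rw [sub_eq_zero.1 h] at hw'; exact hz1.ne' hw'
    have hzw' : z - w ≠ 0 := fun h => hzw (by rw [← neg_sub, h, neg_zero])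
    simp only [smul_smul]
    congr 1
    field_simp
    ring
  have hinv0 : ∀ {r s : ℝ}, 0 < r → ∀ p ∈ annProd r s D, p.1 ≠ 0 := fun hr p hp =>
    norm_pos_iff.1 (hr.trans hp.1)
  -- the two halves, extended past the circles of integration
  have hmapI : MapsTo invFst (annProd a r₂ D) (discProd a⁻¹ D) := fun p hp =>
    ⟨((invFst_mem_annProd ha hr2).2 hp).2.1, hp.2.2⟩
  have hmapI' : MapsTo invFst (annProd b⁻¹ r₁⁻¹ D) (discProd b D) := fun p hp => by
    have := ((invFst_mem_annProd (r₁ := b⁻¹) (r₂ := r₁⁻¹) (by positivity) (by positivity)).2 hp)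
    rw [inv_inv, inv_inv] at this
    exact ⟨this.2.1, hp.2.2⟩
  have hmapf : MapsTo invFst (annProd b⁻¹ r₁⁻¹ D) (annProd r₁ r₂ D) := fun p hp => by
    have := ((invFst_mem_annProd (r₁ := b⁻¹) (r₂ := r₁⁻¹) (by positivity) (by positivity)).2 hp)
    rw [inv_inv, inv_inv] at this
    exact ⟨this.1, this.2.1.trans hb2, hp.2.2⟩
  have dfp' : DifferentiableOn ℂ (fun p => f p - I1 (invFst p)) (annProd a r₂ D) :=
    (hf.mono fun p hp => ⟨ha1.trans hp.1, hp.2⟩).sub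
      (dI1.comp (differentiableOn_invFst (hinv0 ha)) hmapI)
  have dfm' : DifferentiableOn ℂ (fun p => f (invFst p) - I2 (invFst p)) (annProd b⁻¹ r₁⁻¹ D) :=
    have hdi := differentiableOn_invFst (hinv0 (s := r₁⁻¹) (inv_pos.2 hb))
    (hf.comp hdi hmapf).sub (dI2.comp hdi hmapI')
  obtain ⟨fp, dfp, efp1, efp2⟩ := exists_glue (isOpen_discProd hD) (isOpen_annProd hD) dI2 dfp'
    (by
      rintro p ⟨hp1, hp2⟩
      simp only
      rw [hsum p ⟨hp2.1, hp1.1, hp1.2⟩, add_sub_cancel_right])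
  obtain ⟨fm, dfm, efm1, efm2⟩ := exists_glue (isOpen_discProd hD) (isOpen_annProd hD) dI1 dfm'
    (by
      rintro p ⟨hp1, hp2⟩
      simp only
      rw [hsum (invFst p), invFst_invFst, add_sub_cancel_left]
      rw [← inv_inv a, ← inv_inv b]
      exact (invFst_mem_annProd (inv_pos.2 hb) (inv_pos.2 ha)).2 ⟨hp2.1, hp1⟩)
  refine ⟨fp, fm, dfp.mono fun p hp => ?_, dfm.mono fun p hp => ?_, fun p hp => ?_, fun M hM => ?_⟩
  · rcases lt_or_ge ‖p.1‖ b with h | h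
    · exact Or.inl ⟨h, hp.2⟩
    · exact Or.inr ⟨by linarith, hp⟩
  · rcases lt_or_ge ‖p.1‖ a⁻¹ with h | h
    · exact Or.inl ⟨h, hp.2⟩
    · exact Or.inr ⟨(inv_lt_inv₀ hb ha |>.2 (haρ.trans hρb)).trans_le h, hp⟩
  · have hp0 : 0 < ‖p.1‖ := h1.trans hp.1
    rcases lt_or_ge ‖p.1‖ b with h | h
    · have e1 := efm2 (x := invFst p) ((invFst_mem_annProd h1 hb).2 ⟨hp.1, h, hp.2.2⟩)
      rw [efp1 ⟨h, hp.2.2⟩, e1]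
      simp only [invFst_invFst]
      abel
    · have h' : p ∈ annProd a r₂ D := ⟨by linarith, hp.2⟩
      rw [efp2 h', efm1 (hmapI h')]
      simp
  · have hbρ : 0 < b - ρ := by linarith
    have hρa : 0 < ρ - a := by linarith
    have bI2 : ∀ p : ℂ × ℂ, ‖p.1‖ ≤ ρ → p.2 ∈ D → ‖I2 p‖ ≤ b / (b - ρ) * M := by
      intro p hp hpD
      have := circleIntegral.norm_two_pi_i_inv_smul_integral_le_of_norm_le_const hb.le
        (f := fun w => (w - p.1)⁻¹ • f (w, p.2)) (c := 0) (C := (b - ρ)⁻¹ * M) (by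
          intro w hw
          have hw' : ‖w‖ = b := by simpa using hw
          rw [norm_smul, norm_inv]
          have h3 : b - ρ ≤ ‖w - p.1‖ := by
            have := norm_sub_norm_le w p.1
            linarith
          gcongr
          exact hM _ ⟨by simp only; linarith, by simp only; linarith, hpD⟩)
      refine this.trans (le_of_eq ?_)
      ring
    have bI1 : ∀ p : ℂ × ℂ, ‖p.1‖ ≤ ρ⁻¹ → p.2 ∈ D → ‖I1 p‖ ≤ a / (ρ - a) * M := by
      intro p hp hpD
      have := circleIntegral.norm_two_pi_i_inv_smul_integral_le_of_norm_le_const ha.le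
        (f := fun w => (p.1 / (1 - w * p.1)) • f (w, p.2)) (c := 0) (C := (ρ - a)⁻¹ * M) (by
          intro w hw
          have hw' : ‖w‖ = a := by simpa using hw
          rw [norm_smul, norm_div]
          have h3 : 1 - a * ρ⁻¹ ≤ ‖1 - w * p.1‖ := by
            have := norm_sub_norm_le 1 (w * p.1)
            rw [norm_mul, hw', norm_one] at this
            have : a * ‖p.1‖ ≤ a * ρ⁻¹ := by gcongr
            linarith
          have h4 : 0 < 1 - a * ρ⁻¹ := by
            rw [← div_eq_mul_inv, sub_pos, div_lt_one hρ]; exact haρ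
          have h5 : (ρ - a)⁻¹ = ρ⁻¹ / (1 - a * ρ⁻¹) := by
            field_simp
          rw [h5]
          have h6 := hM (w, p.2) ⟨by simp only; linarith, by simp only; linarith, hpD⟩
          gcongr)
      refine this.trans (le_of_eq ?_)
      ring
    have e1 : 0 ≤ b / (b - ρ) := by positivity
    have e2 : 0 ≤ a / (ρ - a) := by positivity
    constructor
    · intro p hp
      rcases le_or_gt ‖p.1‖ ρ with h | h
      · rw [efp1 ⟨by linarith, hp.2⟩]
        have h3 := bI2 p h hp.2
        have hM0 : 0 ≤ M := by
          have := hM (ρ, p.2) ⟨by simp [abs_of_pos hρ]; linarith,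
            by simp [abs_of_pos hρ]; linarith, hp.2⟩
          exact (norm_nonneg _).trans this
        nlinarith [mul_nonneg e2 hM0]
      · have h' : p ∈ annProd a r₂ D := ⟨by linarith, hp⟩
        rw [efp2 h']
        have h4 := hM p ⟨by linarith, hp⟩
        have hM0 := (norm_nonneg _).trans h4
        have h5 := bI1 (invFst p) (by
          simp only [invFst, norm_inv]; exact inv_anti₀ hρ h.le) hp.2
        have := norm_sub_le (f p) (I1 (invFst p))
        nlinarith [mul_nonneg e1 hM0]
    · intro p hp
      rcases le_or_gt ‖p.1‖ ρ⁻¹ with h | h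
      · rw [efm1 ⟨h.trans_lt (inv_strictAnti₀ ha haρ), hp.2⟩]
        have h3 := bI1 p h hp.2
        have hM0 : 0 ≤ M := by
          have := hM (ρ, p.2) ⟨by simp [abs_of_pos hρ]; linarith,
            by simp [abs_of_pos hρ]; linarith, hp.2⟩
          exact (norm_nonneg _).trans this
        nlinarith [mul_nonneg e1 hM0]
      · have h' : p ∈ annProd b⁻¹ r₁⁻¹ D := ⟨(inv_strictAnti₀ hρ hρb).trans h, hp⟩
        rw [efm2 h']
        have h4 := hM _ (hmapf h')
        have hM0 := (norm_nonneg _).trans h4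
        have h5 := bI2 (invFst p) (by
          simp only [invFst, norm_inv]; exact inv_le_of_inv_le₀ hρ h.le) hp.2
        have := norm_sub_le (f (invFst p)) (I2 (invFst p))
        nlinarith [mul_nonneg e2 hM0]

end Laurent

section NearIdentity
variable {R : Type*} [NormedRing R] [NormedAlgebra ℂ R] [CompleteSpace R]

lemma exists_near_one_factorization {r₁ r₂ : ℝ} (h1 : 0 < r₁) (h12 : r₁ < r₂) :
    ∃ δ : ℝ, 0 < δ ∧ ∀ (D : Set ℂ), IsOpen D → ∀ S : ℂ × ℂ → R,
      DifferentiableOn ℂ S (annProd r₁ r₂ D) → (∀ p ∈ annProd r₁ r₂ D, ‖S p - 1‖ ≤ δ) →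
      ∃ P Q : ℂ × ℂ → R, HoloUnits P (discProd r₂ D) ∧ HoloUnits Q (discProd r₁⁻¹ D) ∧
        ∀ p ∈ annProd r₁ r₂ D, S p = P p * Q (invFst p) := by
  obtain ⟨C, hC, hsplit⟩ := exists_laurent_split (G := R) h1 h12
  set N := ‖(1 : R)‖ with hN
  have hN0 : 0 ≤ N := norm_nonneg _
  set q : ℝ := 1 / (2 * (N + 1)) with hq
  have hq0 : 0 < q := by positivity
  have hq1 : q ≤ 1 / 2 := by
    rw [hq]; apply one_div_le_one_div_of_le <;> linarith
  have hNq : N * q * (1 - q)⁻¹ < 1 := by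
    have : (1 - q)⁻¹ ≤ 2 := by
      rw [inv_le_comm₀ (by linarith) (by norm_num)]; linarith
    have h3 : N * q * (1 - q)⁻¹ ≤ N * q * 2 := by gcongr
    have h4 : N * q * 2 = N / (N + 1) := by rw [hq]; field_simp
    have h5 : N / (N + 1) < 1 := by rw [div_lt_one (by linarith)]; linarith
    linarith
  refine ⟨q / C, by positivity, fun D hD S hS hSδ => ?_⟩
  have hsplit' : ∀ f : ℂ × ℂ → R, ∃ fp fm : ℂ × ℂ → R, DifferentiableOn ℂ f (annProd r₁ r₂ D) →
        DifferentiableOn ℂ fp (discProd r₂ D) ∧ DifferentiableOn ℂ fm (discProd r₁⁻¹ D) ∧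
        (∀ p ∈ annProd r₁ r₂ D, f p = fp p + fm (invFst p)) ∧
        ∀ M, (∀ p ∈ annProd r₁ r₂ D, ‖f p‖ ≤ M) →
          (∀ p ∈ discProd r₂ D, ‖fp p‖ ≤ C * M) ∧ ∀ p ∈ discProd r₁⁻¹ D, ‖fm p‖ ≤ C * M := by
    intro f
    by_cases hf : DifferentiableOn ℂ f (annProd r₁ r₂ D)
    · obtain ⟨fp, fm, h⟩ := hsplit D hD f hf
      exact ⟨fp, fm, fun _ => h⟩
    · exact ⟨0, 0, fun h => absurd h hf⟩
  choose Fp Fm hF using hsplit'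
  have hmap : MapsTo invFst (annProd r₁ r₂ D) (discProd r₁⁻¹ D) := fun p hp =>
    ⟨((invFst_mem_annProd h1 (h1.trans h12)).2 hp).2.1, hp.2.2⟩
  have hinv : DifferentiableOn ℂ invFst (annProd r₁ r₂ D) :=
    differentiableOn_invFst fun p hp => norm_pos_iff.1 (h1.trans hp.1)
  let x : ℕ → ℂ × ℂ → R := fun n => Nat.rec (fun _ => 1)
    (fun _ g p => -Fm (fun p => (S p - 1) * g (invFst p)) p) n
  have hx : ∀ n, DifferentiableOn ℂ (x n) (discProd r₁⁻¹ D) ∧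
      ∀ p ∈ discProd r₁⁻¹ D, ‖x n p‖ ≤ N * q ^ n := by
    intro n
    induction n with
    | zero => exact ⟨differentiableOn_const _, fun p _ => by simp [x, hN]⟩
    | succ n ih =>
      have hd : DifferentiableOn ℂ (fun p => (S p - 1) * x n (invFst p)) (annProd r₁ r₂ D) :=
        (hS.sub_const 1).mul (ih.1.comp hinv hmap)
      obtain ⟨-, h2, -, h4⟩ := hF _ hd
      refine ⟨h2.neg, fun p hp => ?_⟩
      have := (h4 (q / C * (N * q ^ n)) fun p hp => (norm_mul_le _ _).trans (by
        gcongr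
        · exact hSδ p hp
        · exact ih.2 _ (hmap hp))).2 p hp
      change ‖-Fm _ p‖ ≤ _
      rw [norm_neg]
      refine this.trans (le_of_eq ?_)
      field_simp
      ring
  let y : ℕ → ℂ × ℂ → R := fun n => Fp (fun p => (S p - 1) * x n (invFst p))
  have hd : ∀ n, DifferentiableOn ℂ (fun p => (S p - 1) * x n (invFst p)) (annProd r₁ r₂ D) :=
    fun n => (hS.sub_const 1).mul ((hx n).1.comp hinv hmap)
  have hy : ∀ n, DifferentiableOn ℂ (y n) (discProd r₂ D) ∧
      ∀ p ∈ discProd r₂ D, ‖y n p‖ ≤ N * q * q ^ n := by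
    intro n
    obtain ⟨h2, -, -, h4⟩ := hF _ (hd n)
    refine ⟨h2, fun p hp => ?_⟩
    have := (h4 (q / C * (N * q ^ n)) fun p hp => (norm_mul_le _ _).trans (by
        gcongr
        · exact hSδ p hp
        · exact (hx n).2 _ (hmap hp))).1 p hp
    refine this.trans (le_of_eq ?_)
    field_simp
  have hxy : ∀ n, ∀ p ∈ annProd r₁ r₂ D,
      (S p - 1) * x n (invFst p) = y n p - x (n + 1) (invFst p) := by
    intro n p hp
    have := (hF _ (hd n)).2.2.1 p hp
    change _ = Fp _ p - -Fm _ _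
    rw [this, sub_neg_eq_add]
  have hgeo := hasSum_geometric_of_lt_one hq0.le (by linarith : q < 1)
  have sx : ∀ p ∈ discProd r₁⁻¹ D, Summable fun n => x n p := fun p hp =>
    Summable.of_norm_bounded (hgeo.summable.mul_left N) fun n => (hx n).2 p hp
  have sy : ∀ p ∈ discProd r₂ D, Summable fun n => y n p := fun p hp =>
    Summable.of_norm_bounded (hgeo.summable.mul_left (N * q)) fun n => (hy n).2 p hp
  have hX1 : ∀ p ∈ discProd r₁⁻¹ D, ∑' n, x n p = 1 + ∑' n, x (n + 1) p := fun p hp => by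
    rw [(sx p hp).tsum_eq_zero_add]
    rfl
  have hX : HoloUnits (fun p => ∑' n, x n p) (discProd r₁⁻¹ D) := by
    refine ⟨differentiableOn_tsum_of_norm_le (isOpen_discProd hD) (fun n => (hx n).1)
      (hgeo.summable.mul_left N) fun n => (hx n).2, fun p hp => isUnit_of_norm_sub_one_lt ?_⟩
    simp only [hX1 p hp, add_sub_cancel_left]
    refine (tsum_of_norm_bounded (hgeo.mul_left (N * q)) fun n => ?_).trans_lt hNq
    exact ((hx (n + 1)).2 p hp).trans_eq (by ring)
  have hP : HoloUnits (fun p => 1 + ∑' n, y n p) (discProd r₂ D) := by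
    refine ⟨(differentiableOn_tsum_of_norm_le (isOpen_discProd hD) (fun n => (hy n).1)
      (hgeo.summable.mul_left (N * q)) fun n => (hy n).2).const_add _,
      fun p hp => isUnit_of_norm_sub_one_lt ?_⟩
    simp only [add_sub_cancel_left]
    exact (tsum_of_norm_bounded (hgeo.mul_left (N * q)) fun n => (hy n).2 p hp).trans_lt hNq
  refine ⟨_, _, hP, hX.inv, fun p hp => ?_⟩
  have hp' := hmap hp
  have hp'' : p ∈ discProd r₂ D := ⟨hp.2.1, hp.2.2⟩
  have e : S p * ∑' n, x n (invFst p) = 1 + ∑' n, y n p := by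
    have e1 : (S p - 1) * ∑' n, x n (invFst p) = ∑' n, y n p - ∑' n, x (n + 1) (invFst p) := by
      rw [← (sx _ hp').tsum_mul_left, tsum_congr fun n => hxy n p hp]
      exact (sy p hp'').tsum_sub ((summable_nat_add_iff 1).2 (sx _ hp'))
    have e2 := hX1 _ hp'
    rw [sub_mul, one_mul, sub_eq_iff_eq_add] at e1
    rw [e1]
    rw [e2]
    abel
  rw [← e, Ring.mul_inverse_cancel_right _ _ (hX.2 _ hp')]

end NearIdentity

section Taylor
variable {E G : Type*} [NormedAddCommGroup E] [NormedSpace ℂ E] [ProperSpace E]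
  [NormedAddCommGroup G] [NormedSpace ℂ G] [CompleteSpace G]

/-- The degree `n` homogeneous Taylor component of `f` at the origin, computed by a Cauchy
integral over the circle of radius `ρ` in each complex line. -/
def homComponent (f : E → G) (n : ℕ) (ρ : ℝ) (p : E) : G :=
  (2 * Real.pi * Complex.I : ℂ)⁻¹ • ∮ w in C(0, ρ), (1 / (w - 0)) ^ n • (w - 0)⁻¹ • f (w • p)

variable {f : E → G} {b : ℝ}

lemma homComponent_eq (hf : DifferentiableOn ℂ f (ball 0 b)) {ρ ρ' : ℝ} {p : E} (hρ : 0 < ρ)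
    (hle : ρ ≤ ρ') (hp : ρ' * ‖p‖ < b) (n : ℕ) : homComponent f n ρ' p = homComponent f n ρ p := by
  unfold homComponent
  congr 1
  have hmem : ∀ w : ℂ, ‖w‖ ≤ ρ' → w • p ∈ ball (0 : E) b := fun w hw => by
    rw [mem_ball_zero_iff, norm_smul]
    exact (by gcongr : ‖w‖ * ‖p‖ ≤ ρ' * ‖p‖).trans_lt hp
  have hd : ∀ w : ℂ, w ≠ 0 → ‖w‖ ≤ ρ' →
      DifferentiableAt ℂ (fun w : ℂ => (1 / (w - 0)) ^ n • (w - 0)⁻¹ • f (w • p)) w := by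
    intro w hw hw'
    have h1 : DifferentiableAt ℂ (fun w : ℂ => f (w • p)) w :=
      (hf.differentiableAt (isOpen_ball.mem_nhds (hmem w hw'))).comp w (by fun_prop)
    have h2 : DifferentiableAt ℂ (fun w : ℂ => (w - 0)⁻¹) w := by
      simp only [sub_zero]; exact differentiableAt_inv hw
    simp only [one_div]
    exact (h2.pow n).smul (h2.smul h1)
  refine Complex.circleIntegral_eq_of_differentiable_on_annulus_off_countable hρ hle
    countable_empty (fun w hw => (hd w ?_ ?_).continuousAt.continuousWithinAt) fun w hw =>
      hd w ?_ ?_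
  · rintro rfl; exact hw.2 (mem_ball_self hρ)
  · simpa using hw.1
  · rintro rfl; exact hw.1.2 (mem_closedBall_self hρ.le)
  · have := hw.1.1; rw [mem_ball_zero_iff] at this; exact this.le

lemma differentiableOn_homComponent (hf : DifferentiableOn ℂ f (ball 0 b)) {ρ : ℝ} (hρ : 0 < ρ)
    (n : ℕ) : DifferentiableOn ℂ (homComponent f n ρ) {p | ρ * ‖p‖ < b} := by
  have hmem : ∀ w ∈ sphere (0 : ℂ) ρ, ∀ p : E, ρ * ‖p‖ < b → w • p ∈ ball (0 : E) b := by
    intro w hw p hp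
    rw [mem_sphere_zero_iff_norm] at hw
    rwa [mem_ball_zero_iff, norm_smul, hw]
  refine DifferentiableOn.const_smul (differentiableOn_circleIntegral
    (F := fun w (p : E) => (1 / (w - 0)) ^ n • (w - 0)⁻¹ • f (w • p)) hρ.le
    (isOpen_lt (by fun_prop) continuous_const) ?_ ?_) _
  · have h2 : ContinuousOn (fun q : ℂ × E => (q.1 - 0)⁻¹) (sphere 0 ρ ×ˢ {p | ρ * ‖p‖ < b}) := by
      refine ContinuousOn.inv₀ (by fun_prop) ?_
      rintro ⟨w, p⟩ ⟨hw, hp⟩ h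
      simp only [sub_zero] at h hw
      rw [h] at hw
      simp at hw
      exact hρ.ne hw
    have h1 : ContinuousOn (fun q : ℂ × E => f (q.1 • q.2)) (sphere 0 ρ ×ˢ {p | ρ * ‖p‖ < b}) :=
      hf.continuousOn.comp (f := fun q : ℂ × E => q.1 • q.2) (by fun_prop)
        fun q hq => hmem _ hq.1 _ hq.2
    simp only [one_div]
    exact (h2.pow n).smul (h2.smul h1)
  · intro w hw
    exact ((hf.comp (f := fun p : E => w • p) (by fun_prop)
      fun p hp => hmem w hw p hp).const_smul _).const_smul _

lemma exists_entire_tendstoUniformlyOn (hf : DifferentiableOn ℂ f (ball 0 b)) {a : ℝ} (ha : 0 < a)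
    (hab : a < b) : ∃ F : ℕ → E → G, (∀ n, Differentiable ℂ (F n)) ∧
      TendstoUniformlyOn F f atTop (closedBall 0 a) := by
  have hb : 0 < b := ha.trans hab
  let c : ℕ → E → G := fun n p => homComponent f n (b / (b + ‖p‖)) p
  have hc : ∀ n, ∀ ρ : ℝ, 0 < ρ → ∀ p, ρ * ‖p‖ < b → c n p = homComponent f n ρ p := by
    intro n ρ hρ p hp
    have hpos : 0 < b / (b + ‖p‖) := by positivity
    have hlt : b / (b + ‖p‖) * ‖p‖ < b := by
      rw [div_mul_eq_mul_div, div_lt_iff₀ (by positivity)]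
      nlinarith [norm_nonneg p]
    rcases le_total ρ (b / (b + ‖p‖)) with h | h
    · exact homComponent_eq hf hρ h hlt n
    · exact (homComponent_eq hf hpos h hp n).symm
  have hcd : ∀ n, Differentiable ℂ (c n) := by
    intro n p
    have hρ : 0 < b / (‖p‖ + 1) := by positivity
    have hopen : IsOpen {q : E | b / (‖p‖ + 1) * ‖q‖ < b} :=
      isOpen_lt (by fun_prop) continuous_const
    have hp : p ∈ {q : E | b / (‖p‖ + 1) * ‖q‖ < b} := by
      rw [mem_ofPred_eq, div_mul_eq_mul_div, div_lt_iff₀ (by positivity)]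
      nlinarith [norm_nonneg p]
    exact ((differentiableOn_homComponent hf hρ n).congr fun q hq =>
      hc n _ hρ q hq).differentiableAt (hopen.mem_nhds hp)
  obtain ⟨t, hat, htb⟩ := exists_between hab
  set ρ := t / a with hρdef
  have hρ1 : 1 < ρ := by rwa [hρdef, one_lt_div ha]
  have hρ0 : 0 < ρ := by linarith
  have hρa : ρ * a = t := by rw [hρdef]; field_simp
  obtain ⟨M, hM⟩ := (isCompact_closedBall (0 : E) t).exists_bound_of_continuousOn
    (hf.continuousOn.mono (closedBall_subset_ball htb))
  have hpt : ∀ p ∈ closedBall (0 : E) a, ρ * ‖p‖ ≤ t := fun p hp => by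
    rw [mem_closedBall_zero_iff] at hp
    rw [← hρa]; gcongr
  have hbound : ∀ n, ∀ p ∈ closedBall (0 : E) a, ‖c n p‖ ≤ M * (ρ⁻¹) ^ n := by
    intro n p hp
    rw [hc n ρ hρ0 p ((hpt p hp).trans_lt htb)]
    have := circleIntegral.norm_two_pi_i_inv_smul_integral_le_of_norm_le_const hρ0.le (c := 0)
      (f := fun w => (1 / (w - 0)) ^ n • (w - 0)⁻¹ • f (w • p)) (C := ρ⁻¹ ^ n * (ρ⁻¹ * M)) (by
        intro w hw
        rw [mem_sphere_zero_iff_norm] at hw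
        simp only [sub_zero, one_div, norm_smul, norm_pow, norm_inv, hw]
        gcongr
        apply hM
        rw [mem_closedBall_zero_iff, norm_smul, hw]
        exact hpt p hp)
    refine this.trans (le_of_eq ?_)
    field_simp
  have hsum : ∀ p ∈ closedBall (0 : E) a, ∑' n, c n p = f p := by
    intro p hp
    obtain ⟨ρ', hρ'⟩ : ∃ ρ' : NNReal, (ρ' : ℝ) = ρ := ⟨ρ.toNNReal, Real.coe_toNNReal _ hρ0.le⟩
    have hdiff : DifferentiableOn ℂ (fun w : ℂ => f (w • p)) (closedBall 0 ρ') :=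
      hf.comp (f := fun w : ℂ => w • p) (by fun_prop) fun w hw => by
        rw [mem_closedBall_zero_iff, hρ'] at hw
        rw [mem_ball_zero_iff, norm_smul]
        refine (mul_le_mul_of_nonneg_right hw (norm_nonneg p)).trans_lt ((hpt p hp).trans_lt htb)
    have hs := (hdiff.hasFPowerSeriesOnBall (by rw [← NNReal.coe_pos, hρ']; exact hρ0)).hasSum
      (y := 1) (by simp only [Metric.eball_coe, mem_ball_zero_iff, norm_one, hρ']; exact hρ1)
    simp only [zero_add, one_smul] at hs
    rw [← hs.tsum_eq]
    refine tsum_congr fun n => ?_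
    rw [hc n ρ hρ0 p ((hpt p hp).trans_lt htb), cauchyPowerSeries_apply, hρ']
    rfl
  refine ⟨fun N p => ∑ n ∈ Finset.range N, c n p, fun N => by fun_prop, ?_⟩
  have hgeo : Summable fun n => M * ρ⁻¹ ^ n :=
    (summable_geometric_of_lt_one (by positivity) (inv_lt_one_of_one_lt₀ hρ1)).mul_left M
  exact (tendstoUniformlyOn_tsum_nat hgeo hbound).congr_right hsum

end Taylor

section Runge
variable {R : Type*} [NormedRing R] [NormedAlgebra ℂ R] [CompleteSpace R]

variable (R) in
lemma exists_holomorphic_log : ∃ δ > 0, ∃ L : R → R, DifferentiableOn ℂ L (ball 1 δ) ∧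
    ∀ x ∈ ball (1 : R) δ, NormedSpace.exp (L x) = x := by
  have hs : HasStrictFDerivAt (𝕜 := ℂ) (NormedSpace.exp : R → R)
      ((ContinuousLinearEquiv.refl ℂ R : R ≃L[ℂ] R) : R →L[ℂ] R) 0 := hasStrictFDerivAt_exp_zero
  have hc : ContDiffAt ℂ 1 (NormedSpace.exp : R → R) 0 :=
    (NormedSpace.exp_analytic (𝕂 := ℂ) (0 : R)).contDiffAt
  have h1 := hc.to_localInverse hs.hasFDerivAt one_ne_zero
  have h2 := h1.eventually (by simp)
  have h3 := hs.eventually_right_inverse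
  rw [NormedSpace.exp_zero] at h2 h3
  obtain ⟨δ, hδ, h⟩ := Metric.eventually_nhds_iff_ball.1 (h2.and h3)
  exact ⟨δ, hδ, _, fun x hx =>
    ((h x hx).1.differentiableAt one_ne_zero).differentiableWithinAt, fun x hx => (h x hx).2⟩

lemma holoUnits_exp {E : Type*} [NormedAddCommGroup E] [NormedSpace ℂ E] {f : E → R} {s : Set E}
    (hf : DifferentiableOn ℂ f s) : HoloUnits (fun p => NormedSpace.exp (f p)) s := by
  let : NormedAlgebra ℚ R := NormedAlgebra.restrictScalars ℚ ℂ R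
  exact ⟨fun p hp => (NormedSpace.exp_analytic (𝕂 := ℂ)
    (f p)).differentiableAt.comp_differentiableWithinAt
    p (hf p hp), fun p _ => NormedSpace.isUnit_exp _⟩

variable {E : Type*} [NormedAddCommGroup E] [NormedSpace ℂ E] [ProperSpace E]

/-- Restrictions to `K` of entire maps to the units of `R`. -/
def entireUnits (R : Type*) [NormedRing R] [NormedAlgebra ℂ R] (K : Set E) : Submonoid C(K, R) where
  carrier := {c | ∃ F : E → R, HoloUnits F univ ∧ ∀ p : K, c p = F p}
  one_mem' := ⟨fun _ => 1, HoloUnits.const isUnit_one, fun _ => rfl⟩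
  mul_mem' := by
    rintro c d ⟨F, hF, hc⟩ ⟨F', hF', hd⟩
    exact ⟨_, hF.mul hF', fun p => by simp [hc, hd]⟩

lemma mem_closure_entireUnits_of_near_one {a b : ℝ} (ha : 0 < a) (hab : a < b) {δ : ℝ} {L : R → R}
    (hL : DifferentiableOn ℂ L (ball 1 δ))
    (hL' : ∀ x ∈ ball (1 : R) δ, NormedSpace.exp (L x) = x) {g : E → R}
    (hg : DifferentiableOn ℂ g (ball 0 b)) (hgδ : MapsTo g (ball 0 b) (ball 1 δ))
    (c : C(closedBall (0 : E) a, R)) (hc : ∀ p, c p = g p) :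
    c ∈ (entireUnits R (closedBall (0 : E) a)).topologicalClosure := by
  have hLg := hL.comp hg hgδ
  have hsub : closedBall (0 : E) a ⊆ ball 0 b := closedBall_subset_ball hab
  obtain ⟨F, hF, hFt⟩ := exists_entire_tendstoUniformlyOn hLg ha hab
  let : NormedAlgebra ℚ R := NormedAlgebra.restrictScalars ℚ ℂ R
  have hexp : Continuous (NormedSpace.exp : R → R) :=
    continuous_iff_continuousAt.2 fun x => (NormedSpace.exp_analytic (𝕂 := ℂ) x).continuousAt
  have : CompactSpace (closedBall (0 : E) a) := isCompact_iff_compactSpace.1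
    (isCompact_closedBall _ _)
  let l : C(closedBall (0 : E) a, R) := ⟨fun p => L (g p),
    continuousOn_iff_continuous_domRestrict.1 (hLg.continuousOn.mono hsub)⟩
  let f : ℕ → C(closedBall (0 : E) a, R) := fun n =>
    ⟨fun p => F n p, (hF n).continuous.comp continuous_subtype_val⟩
  have hlim : Tendsto f atTop (𝓝 l) := by
    rw [ContinuousMap.tendsto_iff_tendstoUniformly]
    exact tendstoUniformlyOn_iff_tendstoUniformly_comp_coe.1 hFt
  have hlim2 := ((ContinuousMap.continuous_postcomp (⟨_, hexp⟩ : C(R, R))).tendsto l).comp hlim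
  have hc' : (⟨_, hexp⟩ : C(R, R)).comp l = c := by
    ext p
    rw [hc]
    exact hL' _ (hgδ (hsub p.2))
  rw [hc'] at hlim2
  exact mem_closure_of_tendsto hlim2 (Eventually.of_forall fun n =>
    ⟨_, holoUnits_exp (hF n).differentiableOn, fun p => rfl⟩)

lemma mem_closure_entireUnits {a b : ℝ} (ha : 0 < a) (hab : a < b) {J : E → R}
    (hJ : HoloUnits J (ball 0 b)) (c : C(closedBall (0 : E) a, R)) (hc : ∀ p, c p = J p) :
    c ∈ (entireUnits R (closedBall (0 : E) a)).topologicalClosure := by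
  obtain ⟨δ, hδ, L, hL, hL'⟩ := exists_holomorphic_log R
  obtain ⟨t, hat, htb⟩ := exists_between hab
  have ht : 0 < t := ha.trans hat
  have hK := isCompact_closedBall (0 : E) t
  have hsub : closedBall (0 : E) t ⊆ ball 0 b := closedBall_subset_ball htb
  obtain ⟨m, hm⟩ := hK.exists_bound_of_continuousOn (hJ.inv.1.continuousOn.mono hsub)
  have hm0 : 0 ≤ m := (norm_nonneg _).trans (hm 0 (mem_closedBall_self ht.le))
  obtain ⟨ε, hε, hunif⟩ := Metric.uniformContinuousOn_iff.1
    (hK.uniformContinuousOn_of_continuous (hJ.1.continuousOn.mono hsub)) (δ / (m + 1))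
        (by positivity)
  obtain ⟨n, hn⟩ := exists_nat_gt (t / ε)
  have hn0 : (0 : ℝ) < n := (by positivity : 0 < t / ε).trans hn
  have key : ∀ k : ℕ, k ≤ n → ∀ c : C(closedBall (0 : E) a, R),
      (∀ p, c p = J (((k : ℂ) / n) • (p : E))) →
      c ∈ (entireUnits R (closedBall (0 : E) a)).topologicalClosure := by
    intro k
    induction k with
    | zero =>
      intro _ c hc
      refine subset_closure ⟨fun _ => J 0, HoloUnits.const (hJ.2 0 (mem_ball_self (ht.trans htb))),
        ?_⟩
      intro p
      simp [hc]
    | succ k ih =>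
      intro hk c hc
      have hmem : ∀ j : ℕ, j ≤ n → ∀ r : ℝ, MapsTo (fun p : E => ((j : ℂ) / n) • p) (ball 0 r)
        (ball 0 r) := by
        intro j hj r p hp
        rw [mem_ball_zero_iff] at hp ⊢
        rw [norm_smul, norm_div, Complex.norm_natCast, Complex.norm_natCast]
        have : (j : ℝ) / n ≤ 1 := by rw [div_le_one hn0]; exact_mod_cast hj
        nlinarith [norm_nonneg p]
      have hJt := hJ.mono (ball_subset_ball htb.le)
      have hJk : ∀ j : ℕ, j ≤ n → HoloUnits (fun p : E => J (((j : ℂ) / n) • p)) (ball 0 t) :=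
        fun j hj => hJt.comp (by fun_prop) (hmem j hj t)
      have hg := (hJk (k + 1) hk).mul (hJk k (by omega)).inv
      have hasub : closedBall (0 : E) a ⊆ ball 0 t := closedBall_subset_ball hat
      let d : C(closedBall (0 : E) a, R) := ⟨fun p => J (((k : ℂ) / n) • (p : E)),
        continuousOn_iff_continuous_domRestrict.1 ((hJk k (by omega)).1.continuousOn.mono hasub)⟩
      let e : C(closedBall (0 : E) a, R) := ⟨fun p => J ((((k + 1 : ℕ) : ℂ) / n) • (p : E)) *
          Ring.inverse (J (((k : ℂ) / n) • (p : E))),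
        continuousOn_iff_continuous_domRestrict.1 (hg.1.continuousOn.mono hasub)⟩
      have hed : c = e * d := by
        ext p
        rw [hc]
        exact (Ring.inverse_mul_cancel_right _ _ ((hJk k (by omega)).2 p (hasub p.2))).symm
      rw [hed]
      refine mul_mem (mem_closure_entireUnits_of_near_one ha hat hL hL' hg.1 ?_ e fun p => rfl)
        (ih (by omega) d fun p => rfl)
      intro p hp
      have hp1 := hmem (k + 1) hk t hp
      have hp2 := hmem k (by omega) t hp
      rw [mem_ball, dist_eq_norm]
      set x := J ((((k + 1 : ℕ) : ℂ) / n) • p)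
      set y := J (((k : ℂ) / n) • p) with hy
      have hyu : IsUnit y := (hJk k (by omega)).2 p hp
      have e1 : x * Ring.inverse y - 1 = (x - y) * Ring.inverse y := by
        rw [sub_mul, Ring.mul_inverse_cancel _ hyu]
      rw [e1]
      have e2 : ‖x - y‖ < δ / (m + 1) := by
        have := hunif _ (ball_subset_closedBall hp1) _ (ball_subset_closedBall hp2) (by
          rw [dist_eq_norm, ← sub_smul, norm_smul]
          have : ((k + 1 : ℕ) : ℂ) / n - (k : ℂ) / n = 1 / n := by push_cast; ring
          rw [this, norm_div, norm_one, Complex.norm_natCast]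
          rw [mem_ball_zero_iff] at hp
          rw [div_lt_iff₀ hε] at hn
          rw [one_div_mul_eq_div, div_lt_iff₀ hn0]
          linarith)
        rwa [dist_eq_norm] at this
      have e3 : ‖Ring.inverse y‖ ≤ m := hm _ (ball_subset_closedBall hp2)
      calc ‖(x - y) * Ring.inverse y‖ ≤ ‖x - y‖ * ‖Ring.inverse y‖ := norm_mul_le _ _
        _ ≤ δ / (m + 1) * m := by gcongr
        _ < δ := by
          rw [div_mul_eq_mul_div, div_lt_iff₀ (by positivity)]
          nlinarith
  refine key n le_rfl c fun p => ?_
  have hnz : (n : ℂ) ≠ 0 := by exact_mod_cast hn0.ne'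
  rw [hc, div_self hnz, one_smul]

lemma exists_entire_right_inverse_approx {a b η : ℝ} (ha : 0 < a) (hab : a < b) (hη : 0 < η)
    {J : E → R} (hJ : HoloUnits J (ball 0 b)) :
    ∃ H : E → R, HoloUnits H univ ∧ ∀ p ∈ closedBall (0 : E) a, ‖J p * H p - 1‖ ≤ η := by
  have hK := isCompact_closedBall (0 : E) a
  have hsub : closedBall (0 : E) a ⊆ ball 0 b := closedBall_subset_ball hab
  obtain ⟨m, hm⟩ := hK.exists_bound_of_continuousOn (hJ.1.continuousOn.mono hsub)
  have hm0 : 0 ≤ m := (norm_nonneg _).trans (hm 0 (mem_closedBall_self ha.le))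
  have : CompactSpace (closedBall (0 : E) a) := isCompact_iff_compactSpace.1 hK
  let c : C(closedBall (0 : E) a, R) := ⟨fun p => Ring.inverse (J p),
    continuousOn_iff_continuous_domRestrict.1 (hJ.inv.1.continuousOn.mono hsub)⟩
  have hmem := mem_closure_entireUnits ha hab hJ.inv c fun p => rfl
  obtain ⟨d, ⟨H, hH, hd⟩, hdist⟩ := Metric.mem_closure_iff.1 hmem (η / (m + 1)) (by positivity)
  refine ⟨H, hH, fun p hp => ?_⟩
  have e1 : J p * H p - 1 = J p * (H p - Ring.inverse (J p)) := by
    rw [mul_sub, Ring.mul_inverse_cancel _ (hJ.2 p (hsub hp))]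
  have e2 : ‖H p - Ring.inverse (J p)‖ ≤ η / (m + 1) := by
    have := (ContinuousMap.dist_apply_le_dist (f := c) (g := d) ⟨p, hp⟩).trans hdist.le
    rw [dist_comm, dist_eq_norm, hd] at this
    exact this
  rw [e1]
  calc ‖J p * (H p - Ring.inverse (J p))‖ ≤ ‖J p‖ * ‖H p - Ring.inverse (J p)‖ := norm_mul_le _ _
    _ ≤ m * (η / (m + 1)) := by gcongr; exact hm p hp
    _ ≤ η := by
      rw [← mul_div_assoc, div_le_iff₀ (by positivity)]
      nlinarith

lemma exists_entire_right_inverse_approx_bidisc {a a' b b' η : ℝ} (ha : 0 < a) (hab : a < b)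
    (ha' : 0 < a') (hab' : a' < b') (hη : 0 < η)
    {J : ℂ × ℂ → R} (hJ : HoloUnits J {p | ‖p.1‖ < b ∧ ‖p.2‖ < b'}) :
    ∃ H : ℂ × ℂ → R, HoloUnits H univ ∧ ∀ p : ℂ × ℂ, ‖p.1‖ ≤ a → ‖p.2‖ ≤ a' →
      ‖J p * H p - 1‖ ≤ η := by
  have hb : 0 < b := ha.trans hab
  have hb' : 0 < b' := ha'.trans hab'
  have hJ' : HoloUnits (fun p : ℂ × ℂ => J ((b : ℂ) * p.1, (b' : ℂ) * p.2)) (ball 0 1) := by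
    refine hJ.comp (φ := fun p : ℂ × ℂ => ((b : ℂ) * p.1, (b' : ℂ) * p.2)) (by fun_prop) ?_
    intro p hp
    rw [mem_ball_zero_iff, Prod.norm_def, max_lt_iff] at hp
    simp only [mem_ofPred_eq, norm_mul, Complex.norm_real, Real.norm_of_nonneg hb.le,
      Real.norm_of_nonneg hb'.le]
    constructor <;> nlinarith
  obtain ⟨H, hH, hH'⟩ := exists_entire_right_inverse_approx (a := max (a / b) (a' / b'))
    (by positivity)
    (max_lt ((div_lt_one hb).2 hab) ((div_lt_one hb').2 hab')) hη hJ'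
  refine ⟨fun p => H ((b : ℂ)⁻¹ * p.1, (b' : ℂ)⁻¹ * p.2), hH.comp
    (φ := fun p : ℂ × ℂ => ((b : ℂ)⁻¹ * p.1, (b' : ℂ)⁻¹ * p.2)) (by fun_prop) (mapsTo_univ _ _), ?_⟩
  intro p hp hp'
  have := hH' ((b : ℂ)⁻¹ * p.1, (b' : ℂ)⁻¹ * p.2) (by
    rw [mem_closedBall_zero_iff, Prod.norm_def]
    simp only [norm_mul, norm_inv, Complex.norm_real, Real.norm_of_nonneg hb.le,
      Real.norm_of_nonneg hb'.le]
    rw [inv_mul_eq_div, inv_mul_eq_div]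
    gcongr)
  have hbz : (b : ℂ) ≠ 0 := by exact_mod_cast hb.ne'
  have hbz' : (b' : ℂ) ≠ 0 := by exact_mod_cast hb'.ne'
  simpa [mul_inv_cancel_left₀ hbz, mul_inv_cancel_left₀ hbz'] using this

end Runge

section Splitting
variable {R : Type*} [NormedRing R] [NormedAlgebra ℂ R] [CompleteSpace R]

section Products
variable {E : Type*} [NormedAddCommGroup E] [NormedSpace ℂ E]

/-- The ordered partial products `g 0 * ⋯ * g (k - 1)`. -/
def orderedProd (g : ℕ → E → R) : ℕ → E → R
  | 0 => fun _ => 1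
  | k + 1 => fun p => orderedProd g k p * g k p

lemma exists_tendsto_orderedProd {g : ℕ → E → R} {s : Set E} (hs : IsOpen s)
    (hg : ∀ k, DifferentiableOn ℂ (g k) s) (hg1 : ∀ k, ∀ p ∈ s, ‖g k p - 1‖ ≤
        (1 / 2 : ℝ) ^ (k + 3)) :
    ∃ U : E → R, HoloUnits U s ∧
      ∀ p ∈ s, Tendsto (fun k => orderedProd g k p) atTop (𝓝 (U p)) := by
  have hd : ∀ k, DifferentiableOn ℂ (orderedProd g k) s := by
    intro k
    induction k with
    | zero => exact differentiableOn_const _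
    | succ k ih => exact ih.mul (hg k)
  have hstep : ∀ k, ∀ p, orderedProd g (k + 1) p - orderedProd g k p =
      (g k p - 1) + (orderedProd g k p - 1) * (g k p - 1) := by
    intro k p
    change orderedProd g k p * g k p - orderedProd g k p = _
    noncomm_ring
  have hb' : ∀ k, ∀ p ∈ s, ‖orderedProd g k p - 1‖ ≤ 1 / 2 →
      ‖orderedProd g (k + 1) p - orderedProd g k p‖ ≤ (1 / 2) ^ (k + 2) := by
    intro k p hp h
    rw [hstep]
    refine (norm_add_le _ _).trans ((add_le_add_right (norm_mul_le _ _) _).trans ?_)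
    have h1 := hg1 k p hp
    have : (0 : ℝ) < (1 / 2) ^ k := by positivity
    rw [pow_add] at h1 ⊢
    nlinarith [norm_nonneg (g k p - 1), mul_le_mul h h1 (norm_nonneg _) (by norm_num)]
  have hb : ∀ k, ∀ p ∈ s, ‖orderedProd g k p - 1‖ ≤ (1 - (1 / 2) ^ k) / 2 := by
    intro k p hp
    induction k with
    | zero => simp [orderedProd]
    | succ k ih =>
      have h0 : (0 : ℝ) < (1 / 2) ^ k := by positivity
      have h1 := hb' k p hp (ih.trans (by linarith))
      have h2 : orderedProd g (k + 1) p - 1 = (orderedProd g (k + 1) p - orderedProd g k p)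
        + (orderedProd g k p - 1) := by abel
      rw [h2]
      refine (norm_add_le _ _).trans ?_
      rw [pow_add] at h1
      rw [pow_succ]
      linarith
  have hinc : ∀ k, ∀ p ∈ s, ‖orderedProd g (k + 1) p - orderedProd g k p‖ ≤ (1 / 2) ^ (k + 2) :=
    fun k p hp => hb' k p hp ((hb k p hp).trans (by
      have : (0 : ℝ) < (1 / 2) ^ k := by positivity
      linarith))
  have hsum : Summable fun k : ℕ => (1 / 2 : ℝ) ^ (k + 2) :=
    (summable_nat_add_iff 2).2 (summable_geometric_of_lt_one (by norm_num) (by norm_num))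
  have hdU := differentiableOn_tsum_of_norm_le hs
    (f := fun k p => orderedProd g (k + 1) p - orderedProd g k p)
    (fun k => (hd (k + 1)).sub (hd k)) hsum hinc
  have hlim : ∀ p ∈ s, Tendsto (fun k => orderedProd g k p) atTop
      (𝓝 (1 + ∑' k, (orderedProd g (k + 1) p - orderedProd g k p))) := by
    intro p hp
    have h1 := (Summable.of_norm_bounded hsum fun k => hinc k p hp).hasSum.tendsto_sum_nat
    have h2 := h1.const_add 1
    refine h2.congr fun n => ?_
    rw [Finset.sum_range_sub (fun k => orderedProd g k p)]
    simp [orderedProd]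
  refine ⟨fun p => 1 + ∑' k, (orderedProd g (k + 1) p - orderedProd g k p),
    ⟨(differentiableOn_const _).add hdU, fun p hp => ?_⟩, hlim⟩
  have h1 := le_of_tendsto' ((hlim p hp).sub_const 1).norm fun k => (hb k p hp).trans (by
    have : (0 : ℝ) < (1 / 2) ^ k := by positivity
    linarith : _ ≤ (1 / 2 : ℝ))
  exact isUnit_of_norm_sub_one_lt (h1.trans_lt (by norm_num))

end Products

/-- The data of a solution `F = M P` of the multiplicative splitting problem over `‖y‖ < R`. -/
structure IsSplitting (M : ℂ × ℂ → R) (r R' : ℝ) (F P : ℂ × ℂ → R) : Prop where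
  left : HoloUnits F {p | p.1 ≠ 0 ∧ ‖p.2‖ < R'}
  right : HoloUnits P {p | ‖p.1‖ < r ∧ ‖p.2‖ < R'}
  eq : ∀ p : ℂ × ℂ, p.1 ≠ 0 → ‖p.1‖ < r → ‖p.2‖ < R' → F p = M p * P p

lemma isOpen_fst_ne_zero : IsOpen {p : ℂ × ℂ | p.1 ≠ 0} :=
    isOpen_ne_fun continuous_fst continuous_const

lemma isOpen_punctured_strip (R' : ℝ) : IsOpen {p : ℂ × ℂ | p.1 ≠ 0 ∧ ‖p.2‖ < R'} :=
  isOpen_fst_ne_zero.inter (isOpen_lt continuous_snd.norm continuous_const)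

lemma isOpen_bidisc (r R' : ℝ) : IsOpen {p : ℂ × ℂ | ‖p.1‖ < r ∧ ‖p.2‖ < R'} :=
  (isOpen_lt continuous_fst.norm continuous_const).inter
    (isOpen_lt continuous_snd.norm continuous_const)

lemma exists_splitting_bounded {ε r₁ r₂ R' : ℝ} (h1 : 0 < r₁) (h12 : r₁ < r₂) (h2 : r₂ < ε)
    (hR : 0 < R') {S Γ : ℂ × ℂ → R} (hS : HoloUnits S {p | ‖p.2‖ < ε})
    (hΓ : HoloUnits Γ {p | p.1 ≠ 0}) :
    ∃ F P, IsSplitting (fun p => S (p.2 / p.1, p.1) * Γ p) r₂ R' F P := by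
  obtain ⟨δ, hδ, hfac⟩ := exists_near_one_factorization (R := R) h1 h12
  set K : Set (ℂ × ℂ) := (closedBall 0 r₂ \ ball 0 r₁) ×ˢ closedBall 0 R' with hKdef
  have hK : IsCompact K := ((isCompact_closedBall _ _).diff isOpen_ball).prod
    (isCompact_closedBall _ _)
  have hK0 : K ⊆ {p | p.1 ≠ 0} := by
    rintro ⟨x, y⟩ ⟨⟨_, hx⟩, _⟩ h0
    simp only at h0 hx
    rw [h0] at hx
    exact hx (mem_ball_self h1)
  obtain ⟨m, hm⟩ := hK.exists_bound_of_continuousOn (hΓ.1.continuousOn.mono hK0)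
  obtain ⟨m', hm'⟩ := hK.exists_bound_of_continuousOn (hΓ.inv.1.continuousOn.mono hK0)
  have hKne : ((r₁ : ℂ), (0 : ℂ)) ∈ K := by
    simp [hKdef, abs_of_pos h1, h12.le, hR.le]
  have hm0 : 0 ≤ m := (norm_nonneg _).trans (hm _ hKne)
  have hm0' : 0 ≤ m' := (norm_nonneg _).trans (hm' _ hKne)
  have hr2 : 0 < r₂ := h1.trans h12
  have hJ : HoloUnits (fun p => Ring.inverse (S p)) {p : ℂ × ℂ | ‖p.1‖ < R' / r₁ + 1 ∧ ‖p.2‖ < ε} :=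
    hS.inv.mono fun p hp => hp.2
  obtain ⟨H, hH, hH1⟩ := exists_entire_right_inverse_approx_bidisc (a := R' / r₁) (by positivity)
    (lt_add_one _) hr2 h2 (η := δ / (m' * m + 1)) (by positivity) hJ
  set D : Set ℂ := ball 0 R' with hD
  set φ : ℂ × ℂ → ℂ × ℂ := fun p => (p.2 / p.1, p.1) with hφ
  have hφd : DifferentiableOn ℂ φ {p | p.1 ≠ 0} := by
    simp only [hφ, div_eq_mul_inv]
    exact (differentiableOn_snd.mul (differentiableOn_fst.inv fun p hp => hp)).prodMk
      differentiableOn_fst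
  have hAnn0 : annProd r₁ r₂ D ⊆ {p | p.1 ≠ 0} := fun p hp => norm_pos_iff.1 (h1.trans hp.1)
  have hSφ : HoloUnits (fun p => S (φ p)) {p | p.1 ≠ 0 ∧ ‖p.1‖ < ε} :=
    hS.comp (hφd.mono fun p hp => hp.1) fun p hp => hp.2
  have hHφ : HoloUnits (fun p => H (φ p)) {p | p.1 ≠ 0} := hH.comp hφd (mapsTo_univ _ _)
  have hAnnε : annProd r₁ r₂ D ⊆ {p | p.1 ≠ 0 ∧ ‖p.1‖ < ε} := fun p hp =>
    ⟨hAnn0 hp, hp.2.1.trans h2⟩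
  have hsig : HoloUnits (fun p => Ring.inverse (Γ p) * Ring.inverse (S (φ p)) * (H (φ p) * Γ p))
      (annProd r₁ r₂ D) :=
    ((hΓ.inv.mono hAnn0).mul (hSφ.inv.mono hAnnε)).mul ((hHφ.mul hΓ).mono hAnn0)
  obtain ⟨P, Q, hP, hQ, hPQ⟩ := hfac D isOpen_ball _ hsig.1 (by
    intro p hp
    have hpK : p ∈ K := by
      refine ⟨⟨?_, ?_⟩, ball_subset_closedBall hp.2.2⟩
      · simpa using hp.2.1.le
      · simpa using hp.1.le
    have hp0 := hAnn0 hp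
    have hpn : 0 < ‖p.1‖ := norm_pos_iff.2 hp0
    have e : Ring.inverse (Γ p) * Ring.inverse (S (φ p)) * (H (φ p) * Γ p) - 1
        = Ring.inverse (Γ p) * (Ring.inverse (S (φ p)) * H (φ p) - 1) * Γ p := by
      rw [mul_sub, sub_mul, mul_one, Ring.inverse_mul_cancel _ (hΓ.2 p hp0)]
      simp only [mul_assoc]
    rw [e]
    have hpR : ‖p.2‖ < R' := by simpa [hD] using hp.2.2
    have h3 := hH1 (φ p) (by
      simp only [hφ, norm_div]
      exact div_le_div₀ hR.le hpR.le h1 hp.1.le) hp.2.1.le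
    calc _ ≤ ‖Ring.inverse (Γ p)‖ * ‖Ring.inverse (S (φ p)) * H (φ p) - 1‖ * ‖Γ p‖ :=
          (norm_mul_le _ _).trans (mul_le_mul_of_nonneg_right (norm_mul_le _ _) (norm_nonneg _))
      _ ≤ m' * (δ / (m' * m + 1)) * m := by
          have := hm p hpK
          have := hm' p hpK
          gcongr
      _ ≤ δ := by
          have : 0 ≤ m' * m := by positivity
          rw [← mul_div_assoc, div_mul_eq_mul_div, div_le_iff₀ (by positivity)]
          nlinarith)
  have hDR : ∀ y : ℂ, y ∈ D ↔ ‖y‖ < R' := fun y => by simp [hD]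
  have hP' : HoloUnits P {p | ‖p.1‖ < r₂ ∧ ‖p.2‖ < R'} := hP.mono fun p hp => ⟨hp.1, (hDR _).2 hp.2⟩
  have hA : HoloUnits (fun p => S (φ p) * Γ p * P p) {p | (p.1 ≠ 0 ∧ ‖p.1‖ < r₂) ∧ ‖p.2‖ < R'} :=
    ((hSφ.mono fun p hp => ⟨hp.1.1, hp.1.2.trans h2⟩).mul (hΓ.mono fun p hp => hp.1.1)).mul
      (hP'.mono fun p hp => ⟨hp.1.2, hp.2⟩)
  have hQ' : HoloUnits (fun p => Q (invFst p)) {p | r₁ < ‖p.1‖ ∧ ‖p.2‖ < R'} :=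
    hQ.comp (differentiableOn_invFst fun p hp => norm_pos_iff.1 (h1.trans hp.1)) fun p hp =>
      ⟨by
        change ‖p.1⁻¹‖ < r₁⁻¹
        rw [norm_inv]; exact inv_strictAnti₀ h1 hp.1, (hDR _).2 hp.2⟩
  have hB : HoloUnits (fun p => H (φ p) * Γ p * Ring.inverse (Q (invFst p)))
      {p | r₁ < ‖p.1‖ ∧ ‖p.2‖ < R'} :=
    ((hHφ.mul hΓ).mono fun p hp => norm_pos_iff.1 (h1.trans hp.1)).mul hQ'.inv
  obtain ⟨F, hF, hFA, -⟩ := hA.exists_glue hB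
    (((isOpen_fst_ne_zero.inter (isOpen_lt continuous_fst.norm continuous_const))).inter
      (isOpen_lt continuous_snd.norm continuous_const))
    ((isOpen_lt continuous_const continuous_fst.norm).inter
      (isOpen_lt continuous_snd.norm continuous_const)) (by
      rintro p ⟨⟨⟨hp0, hp2⟩, hpR⟩, hp1, -⟩
      have hp : p ∈ annProd r₁ r₂ D := ⟨hp1, hp2, (hDR _).2 hpR⟩
      have hQu := hQ'.2 p ⟨hp1, hpR⟩
      have hΓu := hΓ.2 p hp0
      have hSu := hSφ.2 p (hAnnε hp)
      have h4 := hPQ p hp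
      change S (φ p) * Γ p * P p = H (φ p) * Γ p * Ring.inverse (Q (invFst p))
      have h5 : P p = (Ring.inverse (Γ p) * Ring.inverse (S (φ p)) * (H (φ p) * Γ p)) *
          Ring.inverse (Q (invFst p)) := by
        rw [h4, Ring.mul_inverse_cancel_right _ _ hQu]
      rw [h5]
      have h6 : S (φ p) * Γ p * (Ring.inverse (Γ p) * Ring.inverse (S (φ p))) = 1 := by
        rw [mul_assoc, Ring.mul_inverse_cancel_left _ _ hΓu, Ring.mul_inverse_cancel _ hSu]
      simp only [← mul_assoc] at h6 ⊢
      rw [h6, one_mul])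
  refine ⟨F, P, hF.mono fun p hp => ?_, hP', fun p hp0 hp2 hpR => hFA ⟨⟨hp0, hp2⟩, hpR⟩⟩
  rcases lt_or_ge ‖p.1‖ r₂ with h | h
  · exact Or.inl ⟨⟨hp.1, h⟩, hp.2⟩
  · exact Or.inr ⟨h12.trans_le h, hp.2⟩

lemma IsSplitting.exists_next {M : ℂ × ℂ → R} {r R₁ R₂ a η : ℝ} (h : R₁ ≤ R₂) (ha : 0 < a)
    (haR : a < R₁) (hη : 0 < η) (hr0 : 0 < r)
    {F P F' P' : ℂ × ℂ → R}
    (h1 : IsSplitting M r R₁ F P) (h2 : IsSplitting M r R₂ F' P') :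
    ∃ F'' P'' g : ℂ × ℂ → R, IsSplitting M r R₂ F'' P'' ∧ HoloUnits g {p | ‖p.2‖ < R₁} ∧
      (∀ p : ℂ × ℂ, p.1 ≠ 0 → ‖p.2‖ < R₁ → F'' p = F p * g p) ∧
      (∀ p : ℂ × ℂ, ‖p.1‖ < r → ‖p.2‖ < R₁ → P'' p = P p * g p) ∧
      ∀ p : ℂ × ℂ, ‖p.1‖ ≤ a → ‖p.2‖ ≤ a → ‖g p - 1‖ ≤ η := by
  have hl : HoloUnits F' {p | p.1 ≠ 0 ∧ ‖p.2‖ < R₁} := h2.left.mono fun p hp =>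
    ⟨hp.1, hp.2.trans_le h⟩
  have hr : HoloUnits P' {p | ‖p.1‖ < r ∧ ‖p.2‖ < R₁} := h2.right.mono fun p hp =>
    ⟨hp.1, hp.2.trans_le h⟩
  obtain ⟨J, hJ, hJF, hJP⟩ := (h1.left.inv.mul hl).exists_glue (h1.right.inv.mul hr)
    (isOpen_punctured_strip R₁) (isOpen_bidisc r R₁) (by
      rintro p ⟨⟨hp0, hpR⟩, hpr, -⟩
      change Ring.inverse (F p) * F' p = Ring.inverse (P p) * P' p
      have hu := h1.right.2 p ⟨hpr, hpR⟩
      have hFu := h1.left.2 p ⟨hp0, hpR⟩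
      have e : F p * (Ring.inverse (P p) * P' p) = F' p := by
        rw [h1.eq p hp0 hpr hpR, h2.eq p hp0 hpr (hpR.trans_le h), mul_assoc,
          Ring.mul_inverse_cancel_left _ _ hu]
      rw [← e, Ring.inverse_mul_cancel_left _ _ hFu])
  have hJ' : HoloUnits J {p | ‖p.2‖ < R₁} := hJ.mono fun p hp => by
    by_cases h0 : p.1 = 0
    · exact Or.inr ⟨by rw [h0, norm_zero]; exact hr0, hp⟩
    · exact Or.inl ⟨h0, hp⟩
  obtain ⟨H, hH, hH1⟩ := exists_entire_right_inverse_approx_bidisc ha haR ha haR hη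
    (hJ'.mono (t := {p : ℂ × ℂ | ‖p.1‖ < R₁ ∧ ‖p.2‖ < R₁}) fun p hp => hp.2)
  refine ⟨fun p => F' p * H p, fun p => P' p * H p, fun p => J p * H p,
    ⟨h2.left.mul (hH.mono (subset_univ _)), h2.right.mul (hH.mono (subset_univ _)), ?_⟩,
    hJ'.mul (hH.mono (subset_univ _)), ?_, ?_, hH1⟩
  · intro p hp0 hpr hpR
    simp only [h2.eq p hp0 hpr hpR, mul_assoc]
  · intro p hp0 hpR
    have e : J p = Ring.inverse (F p) * F' p := hJF ⟨hp0, hpR⟩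
    simp only [e, mul_assoc]
    rw [Ring.mul_inverse_cancel_left _ _ (h1.left.2 p ⟨hp0, hpR⟩)]
  · intro p hpr hpR
    have e : J p = Ring.inverse (P p) * P' p := hJP ⟨hpr, hpR⟩
    simp only [e, mul_assoc]
    rw [Ring.mul_inverse_cancel_left _ _ (h1.right.2 p ⟨hpr, hpR⟩)]

lemma eq_mul_orderedProd {F : ℕ → ℂ × ℂ → R} {g : ℕ → ℂ × ℂ → R} {s : Set (ℂ × ℂ)} {m : ℕ}
    (h : ∀ n, m ≤ n → ∀ p ∈ s, F (n + 1) p = F n p * g n p) :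
    ∀ k, ∀ p ∈ s, F (k + m) p = F m p * orderedProd (fun j => g (j + m)) k p := by
  intro k p hp
  induction k with
  | zero => simp [orderedProd]
  | succ k ih =>
    rw [show k + 1 + m = k + m + 1 by ring, h _ (by omega) p hp, ih, mul_assoc]
    rfl

lemma exists_holoUnits_limit {F : ℕ → ℂ × ℂ → R} {g : ℕ → ℂ × ℂ → R} {t : Set (ℂ × ℂ)}
    (ht : IsOpen t) (hF : ∀ n : ℕ, HoloUnits (F n) {p | p ∈ t ∧ ‖p.2‖ < (n : ℝ) + 1})
    (hg : ∀ n : ℕ, DifferentiableOn ℂ (g n) {p | ‖p.2‖ < (n : ℝ) + 1})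
    (hg1 : ∀ (n : ℕ) (p : ℂ × ℂ), ‖p.1‖ ≤ (n : ℝ) + 1 / 2 → ‖p.2‖ ≤ (n : ℝ) + 1 / 2 →
      ‖g n p - 1‖ ≤ (1 / 2) ^ (n + 3))
    (h : ∀ n : ℕ, ∀ p ∈ t, ‖p.2‖ < (n : ℝ) + 1 → F (n + 1) p = F n p * g n p) :
    ∃ L : ℂ × ℂ → R, HoloUnits L t ∧ ∀ p ∈ t, Tendsto (fun n => F n p) atTop (𝓝 (L p)) := by
  have key : ∀ m : ℕ, ∃ L : ℂ × ℂ → R,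
      HoloUnits L (t ∩ {p | ‖p.1‖ < (m : ℝ) + 1 / 2 ∧ ‖p.2‖ < (m : ℝ) + 1 / 2}) ∧
      ∀ p ∈ t ∩ {p | ‖p.1‖ < (m : ℝ) + 1 / 2 ∧ ‖p.2‖ < (m : ℝ) + 1 / 2},
        Tendsto (fun n => F n p) atTop (𝓝 (L p)) := by
    intro m
    obtain ⟨U, hU, hlim⟩ := exists_tendsto_orderedProd (g := fun j => g (j + m))
      (isOpen_bidisc ((m : ℝ) + 1 / 2) ((m : ℝ) + 1 / 2)) (fun k => (hg (k + m)).mono fun p hp => by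
        have := hp.2
        simp only [mem_ofPred_eq]; push_cast; have : (0 : ℝ) ≤ k := k.cast_nonneg
        linarith) (fun k p hp => by
        have h0 : (0 : ℝ) ≤ k := k.cast_nonneg
        have h1 := hp.1
        have h2 := hp.2
        refine (hg1 (k + m) p (by push_cast; linarith) (by push_cast; linarith)).trans ?_
        exact pow_le_pow_of_le_one (by norm_num) (by norm_num) (by omega))
    refine ⟨fun p => F m p * U p, ((hF m).mono ?_).mul (hU.mono inter_subset_right), ?_⟩
    · intro p hp
      exact ⟨hp.1, hp.2.2.trans (by linarith)⟩
    · intro p hp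
      rw [← tendsto_add_atTop_iff_nat m]
      have e := eq_mul_orderedProd (F := F) (g := g) (s := {p}) (m := m) (by
        rintro n hn p rfl
        have : (m : ℝ) ≤ n := by exact_mod_cast hn
        exact h n p hp.1 (hp.2.2.trans (by linarith)))
      exact ((hlim p hp.2).const_mul (F m p)).congr fun k => (e k p rfl).symm
  choose L hL hlim using key
  have hex : ∀ p : ℂ × ℂ, ∃ m : ℕ, ‖p.1‖ < (m : ℝ) + 1 / 2 ∧ ‖p.2‖ < (m : ℝ) + 1 / 2 := by
    intro p
    obtain ⟨m, hm⟩ := exists_nat_gt (max ‖p.1‖ ‖p.2‖)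
    rw [max_lt_iff] at hm
    exact ⟨m, by linarith [hm.1], by linarith [hm.2]⟩
  have hl : ∀ m, EqOn (fun p => limUnder atTop fun n => F n p) (L m)
      (t ∩ {p | ‖p.1‖ < (m : ℝ) + 1 / 2 ∧ ‖p.2‖ < (m : ℝ) + 1 / 2}) :=
    fun m p hp => (hlim m p hp).limUnder_eq
  refine ⟨fun p => limUnder atTop fun n => F n p, HoloUnits.of_locally fun p hp => ?_,
    fun p hp => ?_⟩ <;> obtain ⟨m, hm⟩ := hex p
  · exact ⟨_, ht.inter (isOpen_bidisc _ _), ⟨hp, hm⟩, (hL m).congr (hl m)⟩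
  · rw [hl m ⟨hp, hm⟩]
    exact hlim m p ⟨hp, hm⟩

lemma exists_splitting {ε r : ℝ} (hr : 0 < r) (hrε : r < ε) {S Γ : ℂ × ℂ → R}
    (hS : HoloUnits S {p | ‖p.2‖ < ε}) (hΓ : HoloUnits Γ {p | p.1 ≠ 0}) :
    ∃ F P : ℂ × ℂ → R, HoloUnits F {p | p.1 ≠ 0} ∧ HoloUnits P {p | ‖p.1‖ < r} ∧
      ∀ p : ℂ × ℂ, p.1 ≠ 0 → ‖p.1‖ < r → F p = S (p.2 / p.1, p.1) * Γ p * P p := by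
  set M : ℂ × ℂ → R := fun p => S (p.2 / p.1, p.1) * Γ p with hM
  have hex : ∀ n : ℕ, ∃ q : (ℂ × ℂ → R) × (ℂ × ℂ → R), IsSplitting M r ((n : ℝ) + 1) q.1 q.2 := by
    intro n
    obtain ⟨F, P, h⟩ := exists_splitting_bounded (half_pos hr) (half_lt_self hr) hrε
      (R' := (n : ℝ) + 1) (by positivity) hS hΓ
    exact ⟨(F, P), h⟩
  have hnext : ∀ (n : ℕ) (q : {q : (ℂ × ℂ → R) × (ℂ × ℂ → R) //
    IsSplitting M r ((n : ℝ) + 1) q.1 q.2}),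
      ∃ (q' : {q : (ℂ × ℂ → R) × (ℂ × ℂ → R) // IsSplitting M r (((n + 1 : ℕ) : ℝ) + 1) q.1 q.2})
        (g : ℂ × ℂ → R), HoloUnits g {p | ‖p.2‖ < (n : ℝ) + 1} ∧
      (∀ p : ℂ × ℂ, p.1 ≠ 0 → ‖p.2‖ < (n : ℝ) + 1 → q'.1.1 p = q.1.1 p * g p) ∧
      (∀ p : ℂ × ℂ, ‖p.1‖ < r → ‖p.2‖ < (n : ℝ) + 1 → q'.1.2 p = q.1.2 p * g p) ∧
      ∀ p : ℂ × ℂ, ‖p.1‖ ≤ (n : ℝ) + 1 / 2 → ‖p.2‖ ≤ (n : ℝ) + 1 / 2 →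
        ‖g p - 1‖ ≤ (1 / 2) ^ (n + 3) := by
    intro n q
    obtain ⟨q', hq'⟩ := hex (n + 1)
    obtain ⟨F, P, g, h1, h2, h3, h4, h5⟩ := IsSplitting.exists_next (a := (n : ℝ) + 1 / 2)
      (η := (1 / 2) ^ (n + 3)) (by push_cast; linarith) (by positivity) (by linarith)
        (by positivity)
      hr q.2 hq'
    exact ⟨⟨(F, P), h1⟩, g, h2, h3, h4, h5⟩
  choose next g hg hgF hgP hg1 using hnext
  let q : (n : ℕ) → {q : (ℂ × ℂ → R) × (ℂ × ℂ → R) // IsSplitting M r ((n : ℝ) + 1) q.1 q.2} :=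
    fun n => Nat.rec ⟨(hex 0).choose, (hex 0).choose_spec⟩ (fun n q => next n q) n
  have hq : ∀ n, q (n + 1) = next n (q n) := fun n => rfl
  obtain ⟨F, hF, hFl⟩ := exists_holoUnits_limit (F := fun n => (q n).1.1) (g := fun n => g n (q n))
    isOpen_fst_ne_zero (fun n => (q n).2.left) (fun n => (hg n (q n)).1) (fun n => hg1 n (q n))
    (fun n p hp hpn => by rw [hq]; exact hgF n (q n) p hp hpn)
  obtain ⟨P, hP, hPl⟩ := exists_holoUnits_limit (F := fun n => (q n).1.2) (g := fun n => g n (q n))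
    (t := {p | ‖p.1‖ < r}) (isOpen_lt continuous_fst.norm continuous_const)
    (fun n => (q n).2.right) (fun n => (hg n (q n)).1) (fun n => hg1 n (q n))
    (fun n p hp hpn => by rw [hq]; exact hgP n (q n) p hp hpn)
  refine ⟨F, P, hF, hP, fun p hp0 hpr => ?_⟩
  refine tendsto_nhds_unique (hFl p hp0) (((hPl p hpr).const_mul (M p)).congr' ?_)
  obtain ⟨m, hm⟩ := exists_nat_gt ‖p.2‖
  filter_upwards [eventually_ge_atTop m] with n hn
  have : (m : ℝ) ≤ n := by exact_mod_cast hn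
  exact ((q n).2.eq p hp0 hpr (by linarith)).symm

end Splitting

lemma exists_isUnit_row_mul_eq_zero {A : Type*} [CommRing A] [IsDomain A] [IsPrincipalIdealRing A]
    {r : ℕ} (L : Matrix (Fin r) (Fin r) A) (hL : L.det = 0) :
    ∃ Q : Matrix (Fin r) (Fin r) A, IsUnit Q ∧ ∃ i, ∀ j, (Q * L) i j = 0 := by
  obtain ⟨v, hv, hvL⟩ := Matrix.exists_vecMul_eq_zero_iff.2 hL
  set N := LinearMap.ker L.vecMulLinear with hN
  obtain ⟨n, bM, bN, f, a, hsnf⟩ := Submodule.smithNormalForm (Pi.basisFun A (Fin r)) N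
  have hn : n ≠ 0 := by
    rintro rfl
    have : Subsingleton N := bN.repr.toEquiv.subsingleton
    have h0 : (⟨v, hvL⟩ : N) = 0 := Subsingleton.elim _ _
    exact hv (congrArg Subtype.val h0)
  let k : Fin n := ⟨0, Nat.pos_of_ne_zero hn⟩
  have ha : a k ≠ 0 := by
    intro h
    have := hsnf k
    rw [h, zero_smul] at this
    exact bN.ne_zero k (Subtype.ext this)
  have hker : (bM (f k)) ᵥ* L = 0 := by
    have h1 : (bN k : Fin r → A) ᵥ* L = 0 := (bN k).2
    rw [hsnf k, Matrix.smul_vecMul] at h1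
    exact (smul_eq_zero.1 h1).resolve_left ha
  refine ⟨Matrix.of fun i => bM i, ?_, f k, fun j => congrFun hker j⟩
  have h2 : (Matrix.of fun i => bM i : Matrix (Fin r) (Fin r) A) =
      ((Pi.basisFun A (Fin r)).toMatrix bM)ᵀ := by
    ext i j
    simp [Module.Basis.toMatrix_apply]
  rw [h2, Matrix.isUnit_transpose]
  have := (Pi.basisFun A (Fin r)).invertibleToMatrix bM
  exact isUnit_of_invertible _

lemma differentiableOn_dslope_fst {a b : ℝ} {f : ℂ × ℂ → ℂ}
    (hf : DifferentiableOn ℂ f {p | ‖p.1‖ < a ∧ ‖p.2‖ < b}) :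
    DifferentiableOn ℂ (fun p => dslope (fun w => f (w, p.2)) 0 p.1)
      {p : ℂ × ℂ | ‖p.1‖ < a ∧ ‖p.2‖ < b} := by
  rintro p ⟨hpa, hpb⟩
  obtain ⟨ρ, hpρ, hρa⟩ := exists_between hpa
  have hρ : 0 < ρ := (norm_nonneg _).trans_lt hpρ
  have hslice : ∀ q : ℂ × ℂ, ‖q.2‖ < b → DifferentiableOn ℂ (fun w => f (w, q.2)) (ball 0 a) :=
    fun q hq => hf.comp (f := fun w : ℂ => (w, q.2)) (by fun_prop) fun w hw => ⟨by simpa using hw,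
      hq⟩
  have key : EqOn (fun p : ℂ × ℂ => dslope (fun w => f (w, p.2)) 0 p.1)
      (fun q => (2 * Real.pi * Complex.I : ℂ)⁻¹ • ∮ w in C(0, ρ), (w - q.1)⁻¹ •
        (w⁻¹ * (f (w, q.2) - f (0, q.2)))) {q | ‖q.1‖ < ρ ∧ ‖q.2‖ < b} := by
    rintro q ⟨hq1, hq2⟩
    have hd : DifferentiableOn ℂ (dslope (fun w => f (w, q.2)) 0) (ball 0 a) :=
      (Complex.differentiableOn_dslope (isOpen_ball.mem_nhds (mem_ball_self (hρ.trans hρa)))).2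
        (hslice q hq2)
    have h1 := (hd.mono (closedBall_subset_ball hρa)).diffContOnCl_ball Subset.rfl
      |>.two_pi_i_inv_smul_circleIntegral_sub_inv_smul (w := q.1) (by simpa using hq1)
    simp only
    rw [← h1]
    congr 1
    refine circleIntegral.integral_congr hρ.le fun w hw => ?_
    have hw0 : w ≠ 0 := fun h => by simp [h, hρ.ne] at hw
    simp only [dslope_of_ne _ hw0, slope_def_field, sub_zero]
    rw [div_eq_inv_mul]
  have hopen := isOpen_bidisc ρ b
  have hdiff : DifferentiableOn ℂ (fun q : ℂ × ℂ => ∮ w in C(0, ρ), (w - q.1)⁻¹ •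
        (w⁻¹ * (f (w, q.2) - f (0, q.2)))) {q | ‖q.1‖ < ρ ∧ ‖q.2‖ < b} := by
    have hf' : ContinuousOn f {p | ‖p.1‖ < a ∧ ‖p.2‖ < b} := hf.continuousOn
    let Φ : ℂ → ℂ × ℂ → ℂ := fun w q => (w - q.1)⁻¹ • (w⁻¹ * (f (w, q.2) - f (0, q.2)))
    suffices h : ContinuousOn (Function.uncurry Φ) (sphere 0 ρ ×ˢ {q | ‖q.1‖ < ρ ∧ ‖q.2‖ < b}) ∧
        ∀ w ∈ sphere (0 : ℂ) ρ, DifferentiableOn ℂ (Φ w) {q | ‖q.1‖ < ρ ∧ ‖q.2‖ < b} from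
      differentiableOn_circleIntegral hρ.le hopen h.1 h.2
    refine ⟨?_, ?_⟩
    · have h1 : ContinuousOn (fun x : ℂ × ℂ × ℂ => f (x.1, x.2.2))
          (sphere 0 ρ ×ˢ {q : ℂ × ℂ | ‖q.1‖ < ρ ∧ ‖q.2‖ < b}) :=
        hf'.comp (f := fun x : ℂ × ℂ × ℂ => (x.1, x.2.2)) (by fun_prop) fun x hx =>
          ⟨(mem_sphere_zero_iff_norm.1 hx.1).trans_lt hρa, hx.2.2⟩
      have h2 : ContinuousOn (fun x : ℂ × ℂ × ℂ => f (0, x.2.2))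
          (sphere 0 ρ ×ˢ {q : ℂ × ℂ | ‖q.1‖ < ρ ∧ ‖q.2‖ < b}) :=
        hf'.comp (f := fun x : ℂ × ℂ × ℂ => ((0 : ℂ), x.2.2)) (by fun_prop) fun x hx =>
          ⟨by simpa using hρ.trans hρa, hx.2.2⟩
      have h3 : ContinuousOn (fun x : ℂ × ℂ × ℂ => (x.1 - x.2.1)⁻¹)
          (sphere 0 ρ ×ˢ {q : ℂ × ℂ | ‖q.1‖ < ρ ∧ ‖q.2‖ < b}) := by
        refine ContinuousOn.inv₀ (by fun_prop) fun x hx h => ?_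
        have := mem_sphere_zero_iff_norm.1 hx.1
        rw [sub_eq_zero.1 h] at this
        exact hx.2.1.ne this
      have h4 : ContinuousOn (fun x : ℂ × ℂ × ℂ => x.1⁻¹)
          (sphere 0 ρ ×ˢ {q : ℂ × ℂ | ‖q.1‖ < ρ ∧ ‖q.2‖ < b}) := by
        refine ContinuousOn.inv₀ (by fun_prop) fun x hx h => ?_
        have := mem_sphere_zero_iff_norm.1 hx.1
        rw [h, norm_zero] at this
        exact hρ.ne this
      exact h3.smul (h4.mul (h1.sub h2))
    · intro w hw
      rw [mem_sphere_zero_iff_norm] at hw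
      have h1 : DifferentiableOn ℂ (fun q : ℂ × ℂ => f (w, q.2)) {q | ‖q.1‖ < ρ ∧ ‖q.2‖ < b} :=
        hf.comp (f := fun q : ℂ × ℂ => (w, q.2)) (by fun_prop) fun q hq => ⟨hw.trans_lt hρa, hq.2⟩
      have h2 : DifferentiableOn ℂ (fun q : ℂ × ℂ => f (0, q.2)) {q | ‖q.1‖ < ρ ∧ ‖q.2‖ < b} :=
        hf.comp (f := fun q : ℂ × ℂ => ((0 : ℂ), q.2)) (by fun_prop) fun q hq =>
          ⟨by simpa using hρ.trans hρa, hq.2⟩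
      have h3 : DifferentiableOn ℂ (fun q : ℂ × ℂ => (w - q.1)⁻¹) {q | ‖q.1‖ < ρ ∧ ‖q.2‖ < b} := by
        refine DifferentiableOn.inv (by fun_prop) fun q hq h => ?_
        rw [sub_eq_zero.1 h] at hw
        exact hq.1.ne hw
      exact h3.smul ((h1.sub h2).const_mul _)
  have hfin := (DifferentiableOn.fun_const_smul hdiff (2 * Real.pi * Complex.I : ℂ)⁻¹).congr key
  exact (hfin.differentiableAt (hopen.mem_nhds ⟨hpρ, hpb⟩)).differentiableWithinAt

lemma exists_eq_fst_mul_add_snd_mul {a b : ℝ} (ha : 0 < a) (hb : 0 < b) {f : ℂ × ℂ → ℂ}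
    (hf : DifferentiableOn ℂ f {p | ‖p.1‖ < a ∧ ‖p.2‖ < b}) (h0 : f (0, 0) = 0) :
    ∃ g h : ℂ × ℂ → ℂ, DifferentiableOn ℂ g {p | ‖p.1‖ < a ∧ ‖p.2‖ < b} ∧
      DifferentiableOn ℂ h {p | ‖p.1‖ < a ∧ ‖p.2‖ < b} ∧
      ∀ p : ℂ × ℂ, f p = p.1 * g p + p.2 * h p := by
  refine ⟨_, fun p => dslope (fun w => f (0, w)) 0 p.2, differentiableOn_dslope_fst hf, ?_, ?_⟩
  · have h1 : DifferentiableOn ℂ (fun w => f (0, w)) (ball 0 b) :=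
      hf.comp (by fun_prop) fun w hw => ⟨by simpa using ha, by simpa using hw⟩
    have h2 := (Complex.differentiableOn_dslope (isOpen_ball.mem_nhds (mem_ball_self hb))).2 h1
    exact h2.comp differentiableOn_snd fun p hp => by simpa using hp.2
  · intro p
    have e1 := sub_smul_dslope (fun w => f (w, p.2)) 0 p.1
    have e2 := sub_smul_dslope (fun w => f (0, w)) 0 p.2
    simp only [sub_zero, smul_eq_mul, h0] at e1 e2
    rw [e1, e2]; simp

lemma differentiableOn_finsetProd {E ι : Type*} [NormedAddCommGroup E] [NormedSpace ℂ E]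
    {f : ι → E → ℂ} {s : Set E} {u : Finset ι} (h : ∀ i, DifferentiableOn ℂ (f i) s) :
    DifferentiableOn ℂ (fun p => ∏ i ∈ u, f i p) s := by
  classical
  induction u using Finset.induction_on with
  | empty => simp
  | insert i u hi ih => simp only [Finset.prod_insert hi]; exact (h i).mul ih

section MatrixValued
attribute [local instance] Matrix.linftyOpNormedRing Matrix.linftyOpNormedAlgebra

variable {E : Type*} [NormedAddCommGroup E] [NormedSpace ℂ E] {r : ℕ}

lemma differentiableOn_matrix_iff {F : E → Matrix (Fin r) (Fin r) ℂ} {s : Set E} :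
    DifferentiableOn ℂ F s ↔ ∀ i j, DifferentiableOn ℂ (fun p => F p i j) s := by
  constructor
  · intro h i j
    exact ((Matrix.entryLinearMap ℂ
      ℂ i j).toContinuousLinearMap).differentiable.comp_differentiableOn h
  · intro h
    have e : F = fun p => ∑ i, ∑ j, F p i j • Matrix.single i j (1 : ℂ) := by
      funext p
      conv_lhs => rw [Matrix.matrix_eq_sum_single (F p)]
      simp [Matrix.smul_single]
    rw [e]
    exact DifferentiableOn.fun_sum fun i _ => DifferentiableOn.fun_sum fun j _ =>
      (h i j).smul_const _

lemma differentiableOn_det {F : E → Matrix (Fin r) (Fin r) ℂ} {s : Set E}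
    (h : DifferentiableOn ℂ F s) : DifferentiableOn ℂ (fun p => (F p).det) s := by
  rw [differentiableOn_matrix_iff] at h
  simp only [Matrix.det_apply]
  exact DifferentiableOn.fun_sum fun σ _ => DifferentiableOn.const_smul
    (differentiableOn_finsetProd fun i => h _ _) _

end MatrixValued

lemma eqOn_of_eqOn_inter_dense {X Y : Type*} [TopologicalSpace X] [TopologicalSpace Y] [T2Space Y]
    {f g : X → Y} {s t : Set X} (hs : IsOpen s) (ht : Dense t) (hf : ContinuousOn f s)
    (hg : ContinuousOn g s) (h : EqOn f g (s ∩ t)) : EqOn f g s :=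
  h.of_subset_closure hf hg inter_subset_left (ht.open_subset_closure_inter hs)

section OneVariable
variable {G : Type*} [NormedAddCommGroup G] [NormedSpace ℂ G] [CompleteSpace G]

lemma exists_polynomial_approx {f : ℂ → G} {a b η : ℝ} (ha : 0 < a) (hab : a < b) (hη : 0 < η)
    (hf : DifferentiableOn ℂ f (ball 0 b)) :
    ∃ (c : ℕ → G) (n₀ : ℕ), ∀ n, n₀ ≤ n → ∀ z, ‖z‖ ≤ a →
      ‖f z - ∑ k ∈ Finset.range n, z ^ k • c k‖ ≤ η := by
  obtain ⟨t, hat, htb⟩ := exists_between hab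
  have ht : 0 < t := ha.trans hat
  obtain ⟨t', ht'⟩ : ∃ t' : NNReal, (t' : ℝ) = t := ⟨t.toNNReal, Real.coe_toNNReal _ ht.le⟩
  obtain ⟨s, has, hst⟩ := exists_between hat
  have hs : 0 < s := ha.trans has
  obtain ⟨s', hs'⟩ : ∃ s' : NNReal, (s' : ℝ) = s := ⟨s.toNNReal, Real.coe_toNNReal _ hs.le⟩
  have h1 := (hf.mono (closedBall_subset_ball (ht' ▸ htb))).hasFPowerSeriesOnBall
    (by rw [← NNReal.coe_pos, ht']; exact ht)
  have h2 := h1.tendstoUniformlyOn (r' := s') (by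
    rw [ENNReal.coe_lt_coe, ← NNReal.coe_lt_coe, hs', ht']; exact hst)
  rw [Metric.tendstoUniformlyOn_iff] at h2
  obtain ⟨n₀, hn⟩ := eventually_atTop.1 (h2 η hη)
  refine ⟨fun k => (cauchyPowerSeries f 0 t' ).coeff k, n₀, fun n hnn z hz => ?_⟩
  have h3 := hn n hnn z (by
    rw [mem_ball_zero_iff, hs']; exact hz.trans_lt has)
  rw [dist_eq_norm, zero_add] at h3
  simpa [FormalMultilinearSeries.partialSum, FormalMultilinearSeries.apply_eq_pow_smul_coeff]
    using h3.le

lemma exists_laurent_approx {f : ℂ → G} {η : ℝ} (hη : 0 < η)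
    (hf : DifferentiableOn ℂ f {z | z ≠ 0}) :
    ∃ (c d : ℕ → G) (n : ℕ), ∀ z, 1 / 2 ≤ ‖z‖ → ‖z‖ ≤ 2 →
      ‖f z - z ^ n • ((∑ k ∈ Finset.range n, z⁻¹ ^ (n - k) • c k) +
        ∑ k ∈ Finset.range n, z⁻¹ ^ (n + k) • d k)‖ ≤ η := by
  obtain ⟨C, -, h⟩ := exists_laurent_split (G := G) (r₁ := 1 / 4) (r₂ := 4) (by norm_num)
    (by norm_num)
  obtain ⟨fp, fm, hfp, hfm, hfe, -⟩ := h univ isOpen_univ (fun p => f p.1)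
    (hf.comp differentiableOn_fst fun p hp => norm_pos_iff.1 (lt_trans (by norm_num) hp.1))
  have h1 : DifferentiableOn ℂ (fun z : ℂ => fp (z, 0)) (ball 0 4) :=
    hfp.comp (f := fun z : ℂ => (z, (0 : ℂ))) (by fun_prop) fun z hz => ⟨by simpa using hz,
      mem_univ _⟩
  have h2 : DifferentiableOn ℂ (fun z : ℂ => fm (z, 0)) (ball 0 4) :=
    hfm.comp (f := fun z : ℂ => (z, (0 : ℂ))) (by fun_prop) fun z hz =>
      ⟨by norm_num at hz ⊢; exact hz, mem_univ _⟩
  obtain ⟨c, n₀, hc⟩ := exists_polynomial_approx (a := 2) (by norm_num) (by norm_num)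
    (half_pos hη) h1
  obtain ⟨d, m₀, hd⟩ := exists_polynomial_approx (a := 2) (by norm_num) (by norm_num)
    (half_pos hη) h2
  refine ⟨c, d, max n₀ m₀, fun z hz1 hz2 => ?_⟩
  set n := max n₀ m₀
  have hz0 : z ≠ 0 := norm_pos_iff.1 (lt_of_lt_of_le (by norm_num) hz1)
  have e1 : f z = fp (z, 0) + fm (z⁻¹, 0) := hfe (z, 0) ⟨by
    change 1 / 4 < ‖z‖; linarith, by change ‖z‖ < 4; linarith, mem_univ _⟩
  have h3 := hc n (le_max_left _ _) z hz2
  have h4 := hd n (le_max_right _ _) z⁻¹ (by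
    rw [norm_inv]
    exact (inv_anti₀ (by norm_num) hz1).trans (by norm_num))
  have e2 : z ^ n • ((∑ k ∈ Finset.range n, z⁻¹ ^ (n - k) • c k) +
        ∑ k ∈ Finset.range n, z⁻¹ ^ (n + k) • d k) =
      (∑ k ∈ Finset.range n, z ^ k • c k) + ∑ k ∈ Finset.range n, z⁻¹ ^ k • d k := by
    rw [smul_add, Finset.smul_sum, Finset.smul_sum]
    congr 1
    · refine Finset.sum_congr rfl fun k hk => ?_
      rw [smul_smul, ← Nat.sub_add_cancel (Finset.mem_range.1 hk).le, Nat.add_sub_cancel, pow_add,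
        mul_assoc, mul_comm (z ^ k), ← mul_assoc, ← mul_pow, mul_inv_cancel₀ hz0, one_pow, one_mul]
    · refine Finset.sum_congr rfl fun k hk => ?_
      rw [smul_smul, pow_add, ← mul_assoc, ← mul_pow, mul_inv_cancel₀ hz0, one_pow, one_mul]
  rw [e1, e2, add_sub_add_comm]
  exact (norm_add_le _ _).trans (by linarith)

end OneVariable

section Matrices
attribute [local instance] Matrix.linftyOpNormedRing Matrix.linftyOpNormedAlgebra
variable {r : ℕ}

lemma exists_move_roots_to_zero (s : Multiset ℂ) : ∀ (n : ℕ) (Y : ℂ → Matrix (Fin r) (Fin r) ℂ)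
    (g : ℂ → ℂ), (∀ α ∈ s, ‖α‖ ≤ 1 / 2) → DifferentiableOn ℂ Y (ball 0 2) →
    ContinuousOn g (ball 0 2) → (∀ ξ ∈ ball (0 : ℂ) 2, g ξ ≠ 0) →
    (∀ ξ ∈ ball (0 : ℂ) 2, (Y ξ).det = ξ ^ n * (s.map fun α => ξ - α).prod * g ξ) →
    ∃ (A H : ℂ → Matrix (Fin r) (Fin r) ℂ) (m : ℕ) (e : ℂ → ℂ), HoloUnits A (ball 0 2) ∧
      DifferentiableOn ℂ H (ball 0 2) ∧ ContinuousOn e (ball 0 2) ∧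
      (∀ ξ ∈ ball (0 : ℂ) 2, e ξ ≠ 0) ∧ (∀ ξ ∈ ball (0 : ℂ) 2, (H ξ).det = ξ ^ m * e ξ) ∧
      ∀ z : ℂ, 1 / 2 < ‖z‖ → ‖z‖ < 2 → Y z⁻¹ = A z * H z⁻¹ := by
  induction s using Multiset.induction_on with
  | empty =>
    intro n Y g _ hY hg hg0 hdet
    refine ⟨fun _ => 1, Y, n, g, HoloUnits.const isUnit_one, hY, hg, hg0, fun ξ hξ => ?_,
      fun z _ _ => ?_⟩
    · simpa using hdet ξ hξ
    · simp
  | cons α s ih =>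
    intro n Y g hs hY hg hg0 hdet
    have hα : ‖α‖ ≤ 1 / 2 := hs α (Multiset.mem_cons_self α s)
    have hα2 : α ∈ ball (0 : ℂ) 2 := by rw [mem_ball_zero_iff]; linarith
    obtain ⟨K, hK, i, hKi⟩ := exists_isUnit_row_mul_eq_zero (Y α) (by rw [hdet α hα2]; simp)
    have hKd : K.det ≠ 0 := ((Matrix.isUnit_iff_isUnit_det _).1 hK).ne_zero
    have hKY : DifferentiableOn ℂ (fun ξ => K * Y ξ) (ball 0 2) := hY.const_mul K
    have hKY' := differentiableOn_matrix_iff.1 hKY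
    let d : ℂ → Fin r → ℂ := fun ξ j => dslope (fun ξ => (K * Y ξ) i j) α ξ
    have hd : ∀ j, DifferentiableOn ℂ (fun ξ => d ξ j) (ball 0 2) := fun j =>
      (Complex.differentiableOn_dslope (isOpen_ball.mem_nhds hα2)).2 (hKY' i j)
    have hd' : ∀ ξ, (ξ - α) • d ξ = (K * Y ξ) i := by
      intro ξ
      ext j
      have := sub_smul_dslope (fun ξ => (K * Y ξ) i j) α ξ
      simp only [hKi, sub_zero] at this
      exact this
    have hrow : ∀ (f : ℂ → Fin r → ℂ), (∀ j, DifferentiableOn ℂ (fun ξ => f ξ j) (ball 0 2)) →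
        DifferentiableOn ℂ (fun ξ => (K * Y ξ).updateRow i (f ξ)) (ball 0 2) := by
      intro f hf
      refine differentiableOn_matrix_iff.2 fun i' j => ?_
      by_cases h : i' = i
      · subst h; simpa using hf j
      · simpa [h] using hKY' i' j
    let e : ℂ → ℂ := fun ξ => ((K * Y ξ).updateRow i (d ξ)).det
    have hec : ContinuousOn e (ball 0 2) := (differentiableOn_det (hrow d hd)).continuousOn
    have heq : EqOn e
        (fun ξ => ξ ^ n * (s.map fun α => ξ - α).prod * (K.det * g ξ)) (ball 0 2) := by
      refine eqOn_of_eqOn_inter_dense isOpen_ball (dense_compl_singleton α) hec ?_ ?_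
      · refine ContinuousOn.mul (ContinuousOn.mul (by fun_prop) ?_) (hg.const_mul _ )
        exact (continuous_multiset_prod s fun α _ => by fun_prop).continuousOn
      · rintro ξ ⟨hξ, hξα⟩
        have h1 : (ξ - α) * e ξ = K.det * (Y ξ).det := by
          rw [← Matrix.det_mul]
          simp only [e]
          rw [← Matrix.det_updateRow_smul, hd', Matrix.updateRow_eq_self]
        rw [hdet ξ hξ, Multiset.map_cons, Multiset.prod_cons] at h1
        refine mul_left_cancel₀ (sub_ne_zero.2 hξα) (h1.trans ?_)
        ring
    obtain ⟨A, H, m, e', hA, hH, he', he0, hHdet, hYA⟩ := ih (n + 1)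
      (fun ξ => (K * Y ξ).updateRow i (ξ • d ξ)) (fun ξ => K.det * g ξ)
      (fun β hβ => hs β (Multiset.mem_cons_of_mem hβ))
      (hrow _ fun j => differentiableOn_id.mul (hd j)) (hg.const_mul _ )
      (fun ξ hξ => mul_ne_zero hKd (hg0 ξ hξ)) (fun ξ hξ => by
        rw [Matrix.det_updateRow_smul]
        change ξ * e ξ = _
        rw [heq hξ]; ring)
    let B : ℂ → Matrix (Fin r) (Fin r) ℂ := fun z => Matrix.diagonal (Function.update 1 i
      (1 - α * z))
    have hB : HoloUnits B (ball 0 2) := by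
      refine ⟨differentiableOn_matrix_iff.2 fun i' j => ?_, fun z hz => ?_⟩
      · by_cases h : i' = j
        · subst h
          by_cases h' : i' = i
          · subst h'; simp only [B, Matrix.diagonal_apply_eq, Function.update_self]; fun_prop
          · simp [B, h']
        · simp [B, h]
      · rw [Matrix.isUnit_iff_isUnit_det, Matrix.det_diagonal, isUnit_iff_ne_zero,
          Finset.prod_ne_zero_iff]
        intro j _
        by_cases h : j = i
        · subst h
          rw [Function.update_self, sub_ne_zero]
          intro h1
          have h2 := congrArg norm h1
          rw [norm_one, norm_mul] at h2
          rw [mem_ball_zero_iff] at hz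
          nlinarith [norm_nonneg α, norm_nonneg z]
        · simp [h]
    refine ⟨fun z => Ring.inverse K * (B z * A z), H, m, e',
      (HoloUnits.const hK.ringInverse).mul (hB.mul hA), hH, he', he0, hHdet, fun z hz1 hz2 => ?_⟩
    have hz0 : z ≠ 0 := norm_pos_iff.1 (lt_trans (by norm_num) hz1)
    have h1 : K * Y z⁻¹ = B z * (K * Y z⁻¹).updateRow i (z⁻¹ • d z⁻¹) := by
      ext i' j
      simp only [B]
      rw [Matrix.diagonal_mul]
      by_cases h : i' = i
      · subst h
        rw [Function.update_self, Matrix.updateRow_self, ← hd', Pi.smul_apply, Pi.smul_apply,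
          smul_eq_mul, smul_eq_mul]
        field_simp
      · simp [h]
    simp only [mul_assoc]
    rw [← hYA z hz1 hz2, ← h1, Ring.inverse_mul_cancel_left _ _ hK]

end Matrices

section Birkhoff
attribute [local instance] Matrix.linftyOpNormedRing Matrix.linftyOpNormedAlgebra
variable {r : ℕ}

lemma exists_inverse_near_one {R : Type*} [NormedRing R] [CompleteSpace R] {δ : ℝ} (hδ : 0 < δ) :
    ∃ η : ℝ, 0 < η ∧ ∀ x : R, ‖x - 1‖ ≤ η → IsUnit x ∧ ‖Ring.inverse x - 1‖ ≤ δ := by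
  have h := NormedRing.inverse_continuousAt (1 : Rˣ)
  rw [Units.val_one, Metric.continuousAt_iff] at h
  obtain ⟨η, hη, h⟩ := h δ hδ
  refine ⟨min (η / 2) (1 / 2), by positivity, fun x hx => ⟨isUnit_of_norm_sub_one_lt ?_, ?_⟩⟩
  · exact (hx.trans (min_le_right _ _)).trans_lt (by norm_num)
  · have := h (x := x) (by
      rw [dist_eq_norm]
      exact (hx.trans (min_le_left _ _)).trans_lt (by linarith))
    rw [dist_eq_norm, Ring.inverse_one] at this
    exact this.le

lemma isUnit_smul_pow_of_det {H : Matrix (Fin r) (Fin r) ℂ} {z e : ℂ} {m N : ℕ} (hz : z ≠ 0)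
    (he : e ≠ 0) (h : H.det = z⁻¹ ^ m * e) : IsUnit (z ^ N • H) := by
  rw [Matrix.isUnit_iff_isUnit_det, Matrix.det_smul, h, isUnit_iff_ne_zero]
  positivity

lemma exists_det_eq_roots (M : Matrix (Fin r) (Fin r) (Polynomial ℂ))
    (h : ∀ ξ : ℂ, 1 / 2 < ‖ξ‖ → ‖ξ‖ < 2 → (M.map (Polynomial.eval ξ)).det ≠ 0) :
    ∃ (s : Multiset ℂ) (g : ℂ → ℂ), (∀ α ∈ s, ‖α‖ ≤ 1 / 2) ∧ Continuous g ∧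
      (∀ ξ ∈ ball (0 : ℂ) 2, g ξ ≠ 0) ∧
      ∀ ξ, (M.map (Polynomial.eval ξ)).det = (s.map fun α => ξ - α).prod * g ξ := by
  classical
  have hdet : ∀ ξ, (M.map (Polynomial.eval ξ)).det = M.det.eval ξ := fun ξ =>
    ((Polynomial.evalRingHom ξ).map_det M).symm
  have hsplit := (IsAlgClosed.splits M.det).eq_prod_roots
  have hM : M.det ≠ 0 := by
    intro h0
    refine h 1 (by norm_num) (by norm_num) ?_
    rw [hdet, h0, Polynomial.eval_zero]
  have heval : ∀ ξ, M.det.eval ξ = M.det.leadingCoeff * (M.det.roots.map fun α => ξ - α).prod := by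
    intro ξ
    conv_lhs => rw [hsplit]
    rw [Polynomial.eval_mul, Polynomial.eval_C, Polynomial.eval_multiset_prod, Multiset.map_map]
    simp
  refine ⟨M.det.roots.filter fun α => ‖α‖ ≤ 1 / 2, fun ξ => M.det.leadingCoeff *
    ((M.det.roots.filter fun α => ¬ ‖α‖ ≤ 1 / 2).map fun α => ξ - α).prod,
    fun α hα => (Multiset.mem_filter.1 hα).2, ?_, fun ξ hξ => ?_, fun ξ => ?_⟩
  · exact continuous_const.mul (continuous_multiset_prod _ fun α _ => by fun_prop)
  · refine mul_ne_zero (Polynomial.leadingCoeff_ne_zero.2 hM) (Multiset.prod_ne_zero fun h0 => ?_)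
    obtain ⟨α, hα, h1⟩ := Multiset.mem_map.1 h0
    obtain ⟨hα1, hα2⟩ := Multiset.mem_filter.1 hα
    rw [sub_eq_zero] at h1
    subst h1
    refine h ξ (not_le.1 hα2) (by simpa using hξ) ?_
    rw [hdet]
    exact (Polynomial.mem_roots'.1 hα1).2
  · rw [hdet, heval]
    conv_lhs => rw [← Multiset.filter_add_not (fun α => ‖α‖ ≤ 1 / 2) M.det.roots]
    rw [Multiset.map_add, Multiset.prod_add]
    ring

lemma exists_one_variable_factorization {T : ℂ → Matrix (Fin r) (Fin r) ℂ}
    (hT : HoloUnits T {z | z ≠ 0}) :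
    ∃ (A H : ℂ → Matrix (Fin r) (Fin r) ℂ) (N m : ℕ) (e : ℂ → ℂ), HoloUnits A univ ∧
      DifferentiableOn ℂ H (ball 0 2) ∧ ContinuousOn e (ball 0 2) ∧
      (∀ ξ ∈ ball (0 : ℂ) 2, e ξ ≠ 0) ∧ (∀ ξ ∈ ball (0 : ℂ) 2, (H ξ).det = ξ ^ m * e ξ) ∧
      ∀ z : ℂ, 1 / 2 < ‖z‖ → T z = A z * (z ^ N • H z⁻¹) := by
  obtain ⟨δ, hδ, hfac⟩ := exists_near_one_factorization (R := Matrix (Fin r) (Fin r) ℂ)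
    (r₁ := 1 / 2) (r₂ := 2) (by norm_num) (by norm_num)
  obtain ⟨η, hη, hinv⟩ := exists_inverse_near_one (R := Matrix (Fin r) (Fin r) ℂ) hδ
  have hK : IsCompact (closedBall (0 : ℂ) 2 \ ball 0 (1 / 2)) :=
    (isCompact_closedBall _ _).diff isOpen_ball
  obtain ⟨M, hM⟩ := hK.exists_bound_of_continuousOn (hT.inv.1.continuousOn.mono (by
    rintro z ⟨-, hz⟩ rfl
    exact hz (by simp)))
  have hM0 : 0 ≤ M := (norm_nonneg _).trans (hM 1 (by norm_num))
  obtain ⟨c, d, N, hcd⟩ := exists_laurent_approx (η := η / (M + 1)) (by positivity) hT.1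
  let Pm : Matrix (Fin r) (Fin r) (Polynomial ℂ) :=
    (∑ k ∈ Finset.range N, (Polynomial.X ^ (N - k) : Polynomial ℂ) • (c k).map Polynomial.C) +
      ∑ k ∈ Finset.range N, (Polynomial.X ^ (N + k) : Polynomial ℂ) • (d k).map Polynomial.C
  have hPm : ∀ ξ : ℂ, Pm.map (Polynomial.eval ξ) = (∑ k ∈ Finset.range N, ξ ^ (N - k) • c k) +
      ∑ k ∈ Finset.range N, ξ ^ (N + k) • d k := by
    intro ξ
    ext i j
    simp [Pm, Matrix.sum_apply, Polynomial.eval_finsetSum]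
    simp only [mul_comm]
  have hPmd : Differentiable ℂ fun ξ : ℂ => Pm.map (Polynomial.eval ξ) := by
    simp only [hPm]
    fun_prop
  set x : ℂ → Matrix (Fin r) (Fin r) ℂ := fun z => (z ^ N • Pm.map (Polynomial.eval z⁻¹)) *
    Ring.inverse (T z) with hx
  have hx1 : ∀ z : ℂ, 1 / 2 ≤ ‖z‖ → ‖z‖ ≤ 2 → ‖x z - 1‖ ≤ η := by
    intro z hz1 hz2
    have hz0 : z ≠ 0 := norm_pos_iff.1 (lt_of_lt_of_le (by norm_num) hz1)
    have e : x z - 1 = -((T z - z ^ N • Pm.map (Polynomial.eval z⁻¹)) * Ring.inverse (T z)) := by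
      rw [sub_mul, Ring.mul_inverse_cancel _ (hT.2 z hz0), neg_sub]
    have h1 := hcd z hz1 hz2
    rw [← hPm] at h1
    have h2 := hM z ⟨by simpa using hz2, by simpa using hz1⟩
    rw [e, norm_neg]
    calc _ ≤ ‖T z - z ^ N • Pm.map (Polynomial.eval z⁻¹)‖ * ‖Ring.inverse (T z)‖ := norm_mul_le _ _
      _ ≤ η / (M + 1) * M := by gcongr
      _ ≤ η := by
        rw [div_mul_eq_mul_div, div_le_iff₀ (by positivity)]
        nlinarith
  have hann0 : annProd (1 / 2) 2 univ ⊆ {p | p.1 ≠ 0} := fun p hp =>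
    norm_pos_iff.1 (lt_trans (by norm_num) hp.1)
  have hxd : DifferentiableOn ℂ x {z | z ≠ 0} := by
    have hpow : DifferentiableOn ℂ (fun z : ℂ => z ^ N) {z | z ≠ 0} := by fun_prop
    refine (hpow.smul ?_).mul hT.inv.1
    exact hPmd.comp_differentiableOn (differentiableOn_id.inv fun z hz => hz)
  have hxu : HoloUnits (fun p : ℂ × ℂ => x p.1) (annProd (1 / 2) 2 univ) :=
    ⟨hxd.comp differentiableOn_fst hann0, fun p hp => (hinv _ (hx1 p.1 hp.1.le hp.2.1.le)).1⟩
  obtain ⟨P, Q, hP, hQ, hPQ⟩ := hfac univ isOpen_univ _ hxu.inv.1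
    fun p hp => (hinv _ (hx1 p.1 hp.1.le hp.2.1.le)).2
  have hpair : Differentiable ℂ fun z : ℂ => (z, (0 : ℂ)) := by fun_prop
  have hP0 : HoloUnits (fun z : ℂ => P (z, 0)) (ball 0 2) :=
    hP.comp hpair.differentiableOn fun z hz => ⟨by simpa using hz, mem_univ _⟩
  have hQ0 : HoloUnits (fun z : ℂ => Q (z, 0)) (ball 0 2) :=
    hQ.comp hpair.differentiableOn fun z hz => ⟨by norm_num at hz ⊢; exact hz, mem_univ _⟩
  obtain ⟨s, g, hs, hg, hg0, hsg⟩ := exists_det_eq_roots Pm (by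
    intro ξ h1 h2
    have hξ0 : ξ ≠ 0 := norm_pos_iff.1 (lt_trans (by norm_num) h1)
    have h3 := (hinv _ (hx1 ξ⁻¹ (by
      rw [norm_inv, one_div]
      exact inv_anti₀ (norm_pos_iff.2 hξ0) h2.le) (by
      rw [norm_inv]
      exact (inv_anti₀ (by norm_num) h1.le).trans (by norm_num)))).1
    rw [hx] at h3
    simp only [inv_inv] at h3
    rw [Matrix.isUnit_iff_isUnit_det, Matrix.det_mul, Matrix.det_smul] at h3
    exact fun h0 => h3.ne_zero (by rw [h0]; simp))
  obtain ⟨A, H, m, e, hA, hH, he, he0, hdet, hYA⟩ := exists_move_roots_to_zero s 0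
    (fun ξ => Q (ξ, 0) * Pm.map (Polynomial.eval ξ)) (fun ξ => (Q (ξ, 0)).det * g ξ) hs
    (hQ0.1.mul hPmd.differentiableOn)
        ((differentiableOn_det hQ0.1).continuousOn.mul hg.continuousOn)
    (fun ξ hξ => mul_ne_zero ((Matrix.isUnit_iff_isUnit_det _).1 (hQ0.2 ξ hξ)).ne_zero (hg0 ξ hξ))
    (fun ξ hξ => by rw [Matrix.det_mul, hsg]; ring)
  have hV : HoloUnits (fun z : ℂ => z ^ N • H z⁻¹) {z | 1 / 2 < ‖z‖} := by
    have h0 : ∀ z ∈ {z : ℂ | 1 / 2 < ‖z‖}, z ≠ 0 := fun z hz =>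
      norm_pos_iff.1 (lt_trans (by norm_num) hz)
    have hm : MapsTo (fun z : ℂ => z⁻¹) {z | 1 / 2 < ‖z‖} (ball 0 2) := fun z hz => by
      rw [mem_ball_zero_iff, norm_inv]
      exact (inv_strictAnti₀ (by norm_num) hz).trans_eq (by norm_num)
    have hpow : DifferentiableOn ℂ (fun z : ℂ => z ^ N) {z | 1 / 2 < ‖z‖} := by fun_prop
    refine ⟨hpow.smul (hH.comp (differentiableOn_id.inv h0) hm),
      fun z hz => isUnit_smul_pow_of_det (h0 z hz) (he0 _ (hm hz)) (hdet _ (hm hz))⟩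
  have hT' := hT.mono (t := {z | 1 / 2 < ‖z‖}) fun z hz =>
    norm_pos_iff.1 (lt_trans (by norm_num) hz)
  obtain ⟨A', hA', -, hA2⟩ := (hP0.mul hA).exists_glue (hT'.mul hV.inv) isOpen_ball
    (isOpen_lt continuous_const continuous_norm) (by
      rintro z ⟨hz2, hz1⟩
      rw [mem_ball_zero_iff] at hz2
      have hz0 : z ≠ 0 := norm_pos_iff.1 (lt_trans (by norm_num) hz1)
      have h1 := hPQ (z, 0) ⟨hz1, hz2, mem_univ _⟩
      simp only [invFst] at h1
      have h2 := hYA z hz1 hz2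
      have hxz := (hinv _ (hx1 z hz1.le hz2.le)).1
      have h3 : T z = Ring.inverse (x z) * (z ^ N • Pm.map (Polynomial.eval z⁻¹)) := by
        have : z ^ N • Pm.map (Polynomial.eval z⁻¹) = x z * T z := by
          rw [hx]; simp only; rw [Ring.inverse_mul_cancel_right _ _ (hT.2 z hz0)]
        rw [this, Ring.inverse_mul_cancel_left _ _ hxz]
      have h4 : T z = P (z, 0) * A z * (z ^ N • H z⁻¹) := by
        rw [h3, h1, Matrix.mul_smul, Matrix.mul_smul, mul_assoc, h2, mul_assoc]
      change P (z, 0) * A z = T z * Ring.inverse (z ^ N • H z⁻¹)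
      rw [h4, Ring.mul_inverse_cancel_right _ _ (hV.2 z hz1)])
  refine ⟨A', H, N, m, e, hA'.mono fun z _ => ?_, hH, he, he0, hdet, fun z hz => ?_⟩
  · rcases lt_or_ge ‖z‖ 2 with h | h
    · exact Or.inl (by simpa using h)
    · exact Or.inr (lt_of_lt_of_le (by norm_num) h)
  · rw [hA2 hz, Ring.inverse_mul_cancel_right _ _ (hV.2 z hz)]

end Birkhoff

section NearZeroSection
attribute [local instance] Matrix.linftyOpNormedRing Matrix.linftyOpNormedAlgebra
variable {r : ℕ}

lemma exists_factorization_near_zero_section {T : ℂ × ℂ → Matrix (Fin r) (Fin r) ℂ}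
    (hT : HoloUnits T {p | p.1 ≠ 0}) :
    ∃ (ε : ℝ) (S X : ℂ × ℂ → Matrix (Fin r) (Fin r) ℂ) (N m : ℕ) (e : ℂ × ℂ → ℂ), 0 < ε ∧
      HoloUnits S {p | ‖p.2‖ < ε} ∧ DifferentiableOn ℂ X {p | ‖p.1‖ < 2 ∧ ‖p.2‖ < ε} ∧
      ContinuousOn e {p | ‖p.1‖ < 2 ∧ ‖p.2‖ < ε} ∧
      (∀ p : ℂ × ℂ, ‖p.1‖ < 2 → ‖p.2‖ < ε → e p ≠ 0 ∧ (X p).det = p.1 ^ m * e p) ∧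
      ∀ p : ℂ × ℂ, 1 / 2 < ‖p.1‖ → ‖p.2‖ < ε → T p = S p * (p.1 ^ N • X (p.1⁻¹, p.2)) := by
  have hpair : Differentiable ℂ fun z : ℂ => (z, (0 : ℂ)) := by fun_prop
  obtain ⟨A, H, N, m, e, hA, hH, he, he0, hdet, hTA⟩ := exists_one_variable_factorization
    (T := fun z => T (z, 0)) (hT.comp hpair.differentiableOn fun z hz => hz)
  obtain ⟨δ, hδ, hfac⟩ := exists_near_one_factorization (R := Matrix (Fin r) (Fin r) ℂ)
    (r₁ := 1 / 2) (r₂ := 2) (by norm_num) (by norm_num)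
  set W : ℂ × ℂ → Matrix (Fin r) (Fin r) ℂ := fun p =>
    Ring.inverse (A p.1) * (T p * Ring.inverse (T (p.1, 0)) * A p.1) with hW
  have hA' : HoloUnits (fun p : ℂ × ℂ => A p.1) {p | p.1 ≠ 0} :=
    hA.comp differentiableOn_fst (mapsTo_univ _ _)
  have hT0 : HoloUnits (fun p : ℂ × ℂ => T (p.1, 0)) {p | p.1 ≠ 0} :=
    hT.comp (φ := fun p : ℂ × ℂ => (p.1, (0 : ℂ))) (by fun_prop) fun p hp => hp
  have hWu : HoloUnits W {p | p.1 ≠ 0} := hA'.inv.mul ((hT.mul hT0.inv).mul hA')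
  have hW0 : ∀ z : ℂ, z ≠ 0 → W (z, 0) = 1 := by
    intro z hz
    simp only [hW]
    rw [Ring.mul_inverse_cancel _ (hT.2 (z, 0) hz), one_mul, Ring.inverse_mul_cancel _
      (hA.2 z trivial)]
  have hK : IsCompact ((closedBall (0 : ℂ) 2 \ ball 0 (1 / 2)) ×ˢ closedBall (0 : ℂ) 1) :=
    ((isCompact_closedBall _ _).diff isOpen_ball).prod (isCompact_closedBall _ _)
  obtain ⟨ε', hε', hunif⟩ := Metric.uniformContinuousOn_iff.1
    (hK.uniformContinuousOn_of_continuous (hWu.1.continuousOn.mono (by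
      rintro ⟨z, u⟩ ⟨⟨-, hz⟩, -⟩ h0
      simp only at h0 hz
      rw [h0] at hz
      exact hz (by simp)))) δ hδ
  set ε := min ε' 1 with hεdef
  have hε : 0 < ε := lt_min hε' one_pos
  have hDε : ∀ u : ℂ, u ∈ ball (0 : ℂ) ε ↔ ‖u‖ < ε := fun u => by simp
  have hann0 : annProd (1 / 2) 2 (ball 0 ε) ⊆ {p | p.1 ≠ 0} := fun p hp =>
    norm_pos_iff.1 (lt_trans (by norm_num) hp.1)
  obtain ⟨P, Q, hP, hQ, hPQ⟩ := hfac (ball 0 ε) isOpen_ball W (hWu.1.mono hann0) (by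
    rintro ⟨z, u⟩ hp
    have hz : z ∈ closedBall (0 : ℂ) 2 \ ball 0 (1 / 2) :=
      ⟨by simpa using hp.2.1.le, by simpa using hp.1.le⟩
    have hu : ‖u‖ < ε := (hDε _).1 hp.2.2
    have h1 := hunif (z, u) ⟨hz, by simpa using (hu.trans_le (min_le_right _ _)).le⟩ (z, 0)
      ⟨hz, by simp⟩ (by
        rw [Prod.dist_eq]
        simpa using hu.trans_le (min_le_left _ _))
    rw [dist_eq_norm, hW0 z (hann0 hp)] at h1
    exact h1.le)
  have hP' : HoloUnits P {p | ‖p.1‖ < 2 ∧ ‖p.2‖ < ε} := hP.mono fun p hp => ⟨hp.1, (hDε _).2 hp.2⟩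
  have hQ' : HoloUnits Q {p | ‖p.1‖ < 2 ∧ ‖p.2‖ < ε} := hQ.mono fun p hp =>
    ⟨by norm_num; exact hp.1, (hDε _).2 hp.2⟩
  have hfst : MapsTo (fun p : ℂ × ℂ => p.1) {p | ‖p.1‖ < 2 ∧ ‖p.2‖ < ε} (ball 0 2) := fun p hp => by
    simpa using hp.1
  set X : ℂ × ℂ → Matrix (Fin r) (Fin r) ℂ := fun p => Q p * H p.1 with hX
  have hXd : DifferentiableOn ℂ X {p | ‖p.1‖ < 2 ∧ ‖p.2‖ < ε} :=
    hQ'.1.mul (hH.comp differentiableOn_fst hfst)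
  have hXdet : ∀ p : ℂ × ℂ, ‖p.1‖ < 2 → ‖p.2‖ < ε →
      (Q p).det * e p.1 ≠ 0 ∧ (X p).det = p.1 ^ m * ((Q p).det * e p.1) := by
    intro p h1 h2
    refine ⟨mul_ne_zero ((Matrix.isUnit_iff_isUnit_det _).1 (hQ'.2 p ⟨h1, h2⟩)).ne_zero
      (he0 _ (hfst ⟨h1, h2⟩)), ?_⟩
    rw [hX, Matrix.det_mul, hdet _ (hfst ⟨h1, h2⟩)]
    ring
  have hin : ∀ p : ℂ × ℂ, 1 / 2 < ‖p.1‖ → ‖p.1⁻¹‖ < 2 := fun p hp => by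
    rw [norm_inv]
    exact (inv_strictAnti₀ (by norm_num) hp).trans_eq (by norm_num)
  have hout0 : ∀ p ∈ {p : ℂ × ℂ | 1 / 2 < ‖p.1‖ ∧ ‖p.2‖ < ε}, p.1 ≠ 0 := fun p hp =>
    norm_pos_iff.1 (lt_trans (by norm_num) hp.1)
  have hV : HoloUnits (fun p : ℂ × ℂ => p.1 ^ N • X (p.1⁻¹, p.2))
      {p | 1 / 2 < ‖p.1‖ ∧ ‖p.2‖ < ε} := by
    have hpow : DifferentiableOn ℂ (fun p : ℂ × ℂ => p.1 ^ N) {p | 1 / 2 < ‖p.1‖ ∧ ‖p.2‖ < ε} := by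
      fun_prop
    refine ⟨hpow.smul (hXd.comp (f := fun p : ℂ × ℂ => (p.1⁻¹, p.2))
      (differentiableOn_invFst hout0) fun p hp => ⟨hin p hp.1, hp.2⟩), fun p hp => ?_⟩
    exact isUnit_smul_pow_of_det (hout0 p hp) (hXdet (p.1⁻¹, p.2) (hin p hp.1) hp.2).1
      (hXdet (p.1⁻¹, p.2) (hin p hp.1) hp.2).2
  obtain ⟨S, hS, -, hS2⟩ := HoloUnits.exists_glue
    (((hA.comp (φ := fun p : ℂ × ℂ => p.1) differentiableOn_fst (mapsTo_univ _ _)).mul hP'))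
    ((hT.mono hout0).mul hV.inv) (isOpen_bidisc 2 ε)
    ((isOpen_lt continuous_const continuous_fst.norm).inter
      (isOpen_lt continuous_snd.norm continuous_const)) (by
      rintro p ⟨⟨hp2, hpε⟩, hp1, -⟩
      have hp0 := hout0 p ⟨hp1, hpε⟩
      have h1 := hPQ p ⟨hp1, hp2, (hDε _).2 hpε⟩
      have h2 := hTA p.1 hp1
      have h3 : T p = A p.1 * W p * (p.1 ^ N • H p.1⁻¹) := by
        have e1 : A p.1 * W p = T p * Ring.inverse (T (p.1, 0)) * A p.1 := by
          simp only [hW]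
          rw [Ring.mul_inverse_cancel_left _ _ (hA.2 p.1 trivial)]
        rw [e1, mul_assoc, ← h2, Ring.inverse_mul_cancel_right _ _ (hT0.2 p hp0)]
      have h4 : T p = A p.1 * P p * (p.1 ^ N • X (p.1⁻¹, p.2)) := by
        rw [h3, h1]
        simp only [hX, Matrix.mul_smul, mul_assoc, invFst]
      change A p.1 * P p = T p * Ring.inverse (p.1 ^ N • X (p.1⁻¹, p.2))
      rw [h4, Ring.mul_inverse_cancel_right _ _ (hV.2 p ⟨hp1, hpε⟩)])
  refine ⟨ε, S, X, N, m, fun p => (Q p).det * e p.1, hε, hS.mono fun p hp => ?_, hXd,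
    (differentiableOn_det hQ'.1).continuousOn.mul (he.comp continuous_fst.continuousOn hfst),
    hXdet, fun p h1 h2 => ?_⟩
  · rcases lt_or_ge ‖p.1‖ 2 with h | h
    · exact Or.inl ⟨h, hp⟩
    · exact Or.inr ⟨lt_of_lt_of_le (by norm_num) h, hp⟩
  · rw [hS2 ⟨h1, h2⟩, Ring.inverse_mul_cancel_right _ _ (hV.2 p ⟨h1, h2⟩)]

end NearZeroSection

section Elementary
attribute [local instance] Matrix.linftyOpNormedRing Matrix.linftyOpNormedAlgebra
variable {r : ℕ}

/-- The ring of functions which are holomorphic on `s`. -/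
def holoRing (s : Set (ℂ × ℂ)) : Subring (ℂ × ℂ → ℂ) where
  carrier := {f | DifferentiableOn ℂ f s}
  mul_mem' := fun hf hg => DifferentiableOn.mul hf hg
  one_mem' := differentiableOn_const _
  add_mem' := fun hf hg => DifferentiableOn.add hf hg
  zero_mem' := differentiableOn_const _
  neg_mem' := fun hf => DifferentiableOn.neg hf

/-- Evaluation of a holomorphic function at a point. -/
def holoEval (s : Set (ℂ × ℂ)) (p : ℂ × ℂ) : holoRing s →+* ℂ :=
  (Pi.evalRingHom (fun _ => ℂ) p).comp (holoRing s).subtype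

/-- The constants, as holomorphic functions. -/
def holoConst (s : Set (ℂ × ℂ)) : ℂ →+* holoRing s :=
  (Pi.constRingHom (ℂ × ℂ) ℂ).codRestrict (holoRing s) fun _ => differentiableOn_const _

/-- Evaluation of a polynomial in `v` with holomorphic coefficients in `(ξ, u)` along `u = ξ v`. -/
def blowupEval (s : Set (ℂ × ℂ)) (q : ℂ × ℂ) : Polynomial (holoRing s) →+* ℂ :=
  Polynomial.eval₂RingHom (holoEval s (q.1, q.1 * q.2)) q.2

variable {s : Set (ℂ × ℂ)}

lemma blowupEval_C (f : holoRing s) (q : ℂ × ℂ) :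
    blowupEval s q (Polynomial.C f) = (f : ℂ × ℂ → ℂ) (q.1, q.1 * q.2) :=
  Polynomial.eval₂_C _ _

lemma blowupEval_X (q : ℂ × ℂ) : blowupEval s q Polynomial.X = q.2 :=
  Polynomial.eval₂_X _ _

lemma blowupEval_map_holoConst (p : Polynomial ℂ) (q : ℂ × ℂ) :
    blowupEval s q (p.map (holoConst s)) = p.eval q.2 := by
  change Polynomial.eval₂ _ _ _ = _
  rw [Polynomial.eval₂_map, ← Polynomial.eval₂_id]
  rfl

lemma blowupEval_zero_fst (p : Polynomial (holoRing s)) (v : ℂ) :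
    blowupEval s (0, v) p = (p.map (holoEval s (0, 0))).eval v := by
  rw [Polynomial.eval_map]
  simp [blowupEval]

lemma map_holoEval_map_holoConst (p : Polynomial ℂ) (q : ℂ × ℂ) :
    (p.map (holoConst s)).map (holoEval s q) = p := by
  rw [Polynomial.map_map]
  exact Polynomial.map_id

lemma differentiableOn_blowupEval (p : Polynomial (holoRing s)) :
    DifferentiableOn ℂ (fun q => blowupEval s q p) {q | (q.1, q.1 * q.2) ∈ s} := by
  induction p using Polynomial.induction_on' with
  | add p q hp hq => simpa only [map_add] using hp.fun_add hq
  | monomial n f =>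
    have e : ∀ q, blowupEval s q (Polynomial.monomial n f) =
        (f : ℂ × ℂ → ℂ) (q.1, q.1 * q.2) * q.2 ^ n := fun q => Polynomial.eval₂_monomial _ _
    simp only [e]
    have hf : DifferentiableOn ℂ (f : ℂ × ℂ → ℂ) s := f.2
    have hpow : DifferentiableOn ℂ (fun q : ℂ × ℂ => q.2 ^ n) {q | (q.1, q.1 * q.2) ∈ s} := by
      fun_prop
    exact (hf.comp (f := fun q : ℂ × ℂ => (q.1, q.1 * q.2)) (by fun_prop) fun q hq => hq).mul hpow

lemma exists_blowupEval_eq_mul {a b : ℝ} (ha : 0 < a) (hb : 0 < b)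
    (p : Polynomial (holoRing {p : ℂ × ℂ | ‖p.1‖ < a ∧ ‖p.2‖ < b}))
    (hp : p.map (holoEval _ (0, 0)) = 0) :
    ∃ p' : Polynomial (holoRing {p : ℂ × ℂ | ‖p.1‖ < a ∧ ‖p.2‖ < b}),
      ∀ q, blowupEval _ q p = q.1 * blowupEval _ q p' := by
  have hc : ∀ n, ∃ g h : holoRing {p : ℂ × ℂ | ‖p.1‖ < a ∧ ‖p.2‖ < b}, ∀ q : ℂ × ℂ,
      (p.coeff n : ℂ × ℂ → ℂ) q = q.1 * (g : ℂ × ℂ → ℂ) q + q.2 * (h : ℂ × ℂ → ℂ) q := by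
    intro n
    have h0 : (p.coeff n : ℂ × ℂ → ℂ) (0, 0) = 0 := by
      have := congrArg (fun P => Polynomial.coeff P n) hp
      simp only [Polynomial.coeff_map, Polynomial.coeff_zero] at this
      exact this
    obtain ⟨g, h, hg, hh, e⟩ := exists_eq_fst_mul_add_snd_mul ha hb (p.coeff n).2 h0
    exact ⟨⟨g, hg⟩, ⟨h, hh⟩, e⟩
  choose g h e using hc
  refine ⟨∑ n ∈ p.support, Polynomial.C (g n) * Polynomial.X ^ n +
    ∑ n ∈ p.support, Polynomial.C (h n) * Polynomial.X ^ (n + 1), fun q => ?_⟩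
  conv_lhs => rw [p.as_sum_support_C_mul_X_pow]
  simp only [map_add, map_sum, map_mul, map_pow, blowupEval_C, blowupEval_X, e]
  rw [← Finset.sum_add_distrib, Finset.mul_sum]
  refine Finset.sum_congr rfl fun n _ => ?_
  ring

lemma exists_elementary_factorization {a b : ℝ} (ha : 0 < a) (hb : 0 < b) (n : ℕ)
    (M : Matrix (Fin r) (Fin r) (Polynomial (holoRing {p : ℂ × ℂ | ‖p.1‖ < a ∧ ‖p.2‖ < b})))
    (e : ℂ × ℂ → ℂ)
    (he : ContinuousOn e {q | q.2 ≠ 0 ∧ ‖q.1‖ < a ∧ ‖q.1 * q.2‖ < b})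
    (he0 : ∀ q ∈ {q : ℂ × ℂ | q.2 ≠ 0 ∧ ‖q.1‖ < a ∧ ‖q.1 * q.2‖ < b}, e q ≠ 0)
    (hdet : ∀ q ∈ {q : ℂ × ℂ | q.2 ≠ 0 ∧ ‖q.1‖ < a ∧ ‖q.1 * q.2‖ < b},
      ((blowupEval _ q).mapMatrix M).det = (q.1 * q.2) ^ n * e q) :
    ∃ G C : ℂ × ℂ → Matrix (Fin r) (Fin r) ℂ, HoloUnits G {p | p.1 ≠ 0} ∧
      HoloUnits C {q | q.2 ≠ 0 ∧ ‖q.1‖ < a ∧ ‖q.1 * q.2‖ < b} ∧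
      ∀ q ∈ {q : ℂ × ℂ | q.2 ≠ 0 ∧ ‖q.1‖ < a ∧ ‖q.1 * q.2‖ < b}, q.1 ≠ 0 →
        C q = G (q.1 * q.2, q.2) * (blowupEval _ q).mapMatrix M := by
  set W : Set (ℂ × ℂ) := {q | q.2 ≠ 0 ∧ ‖q.1‖ < a ∧ ‖q.1 * q.2‖ < b} with hW
  have hWopen : IsOpen W := (isOpen_ne_fun continuous_snd continuous_const).inter
    ((isOpen_lt continuous_fst.norm continuous_const).inter
      (isOpen_lt (continuous_fst.mul continuous_snd).norm continuous_const))
  have hMd : ∀ M : Matrix (Fin r) (Fin r) (Polynomial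
    (holoRing {p : ℂ × ℂ | ‖p.1‖ < a ∧ ‖p.2‖ < b})),
      DifferentiableOn ℂ (fun q => (blowupEval _ q).mapMatrix M) W := fun M =>
    differentiableOn_matrix_iff.2 fun i j => (differentiableOn_blowupEval (M i j)).mono fun q hq =>
      hq.2
  induction n generalizing M e with
  | zero =>
    refine ⟨fun _ => 1, _, .const isUnit_one, ⟨hMd M, fun q hq => ?_⟩,
      fun q _ _ => (one_mul _).symm⟩
    rw [Matrix.isUnit_iff_isUnit_det, hdet q hq, pow_zero, one_mul]
    exact (he0 q hq).isUnit
  | succ n ih =>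
    set L := (Polynomial.mapRingHom (holoEval _ (0, 0))).mapMatrix M with hL
    have hL0 : L.det = 0 := by
      refine Polynomial.eq_zero_of_infinite_isRoot _ (Set.Infinite.mono (s := {0}ᶜ) ?_
        (Set.finite_singleton (0 : ℂ)).infinite_compl)
      intro v hv
      have h1 := hdet (0, v) ⟨hv, by simpa using ha, by simpa using hb⟩
      rw [← RingHom.map_det, blowupEval_zero_fst] at h1
      rw [mem_ofPred_eq, Polynomial.IsRoot, hL, ← RingHom.map_det]
      simpa using h1
    obtain ⟨Q, hQ, i, hQi⟩ := exists_isUnit_row_mul_eq_zero L hL0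
    set N := (Polynomial.mapRingHom (holoConst _)).mapMatrix Q * M with hN
    have hNi : ∀ j, (N i j).map (holoEval _ (0, 0)) = 0 := by
      intro j
      rw [← hQi j, hN, Matrix.mul_apply, Matrix.mul_apply, Polynomial.map_sum]
      refine Finset.sum_congr rfl fun k _ => ?_
      rw [Polynomial.map_mul]
      congr 1
      exact map_holoEval_map_holoConst _ _
    choose P hP using fun j => exists_blowupEval_eq_mul ha hb (N i j) (hNi j)
    set M' : Matrix (Fin r) (Fin r) (Polynomial (holoRing {p : ℂ × ℂ | ‖p.1‖ < a ∧ ‖p.2‖ < b})) :=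
      Matrix.of fun k j => if k = i then P j else Polynomial.X * N k j with hM'
    set D : ℂ → Matrix (Fin r) (Fin r) ℂ := fun x =>
      Matrix.diagonal fun k => if k = i then x⁻¹ else 1 with hD
    set Qe : ℂ → Matrix (Fin r) (Fin r) ℂ := fun y =>
      (Polynomial.evalRingHom y).mapMatrix Q with hQe
    have hDdet : ∀ x, (D x).det = x⁻¹ := fun x => by simp [hD, Matrix.det_diagonal]
    have hQunit : ∀ y, IsUnit (Qe y) := fun y => hQ.map _
    have hNe : ∀ q, (blowupEval _ q).mapMatrix N = Qe q.2 * (blowupEval _ q).mapMatrix M := by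
      intro q
      rw [hN, map_mul]
      congr 1
      ext k j
      exact blowupEval_map_holoConst _ _
    have hM'e : ∀ q ∈ W, q.1 ≠ 0 → (blowupEval _ q).mapMatrix M' =
        q.2 • (D (q.1 * q.2) * Qe q.2 * (blowupEval _ q).mapMatrix M) := by
      intro q hq hq1
      rw [mul_assoc, ← hNe]
      ext k j
      have hq2 : q.2 ≠ 0 := hq.1
      by_cases hk : k = i
      · subst hk
        simp only [hM', hD, RingHom.mapMatrix_apply, Matrix.map_apply, Matrix.of_apply, if_true,
          Matrix.smul_apply, Matrix.diagonal_mul, hP, smul_eq_mul]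
        field_simp
      · simp [hM', hD, hk, blowupEval_X]
    have he' : ContinuousOn (fun q : ℂ × ℂ => q.2 ^ r * (Qe q.2).det * e q) W := by
      have hQd : ∀ q : ℂ × ℂ, (Qe q.2).det = Q.det.eval q.2 := fun q =>
        ((Polynomial.evalRingHom q.2).map_det Q).symm
      simp only [hQd]
      fun_prop
    have hdetM' : ∀ q ∈ W, ((blowupEval _ q).mapMatrix M').det =
        (q.1 * q.2) ^ n * (q.2 ^ r * (Qe q.2).det * e q) := by
      refine eqOn_of_eqOn_inter_dense hWopen
        ((dense_compl_singleton (0 : ℂ)).preimage isOpenMap_fst)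
        (differentiableOn_det (hMd M')).continuousOn ?_ ?_
      · have h1 : Continuous fun q : ℂ × ℂ => (q.1 * q.2) ^ n := by fun_prop
        exact h1.continuousOn.mul he'
      · rintro q ⟨hq, hq1⟩
        have hq1' : q.1 ≠ 0 := hq1
        have hq2 : q.2 ≠ 0 := hq.1
        simp only
        rw [hM'e q hq hq1, Matrix.det_smul, Matrix.det_mul, Matrix.det_mul, hDdet, hdet q hq,
          Fintype.card_fin, pow_succ]
        field_simp
    obtain ⟨G, C, hG, hC, hGC⟩ := ih M' (fun q => q.2 ^ r * (Qe q.2).det * e q) he'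
      (fun q hq => mul_ne_zero (mul_ne_zero (pow_ne_zero _ hq.1)
        ((Matrix.isUnit_iff_isUnit_det _).1 (hQunit _)).ne_zero) (he0 q hq)) hdetM'
    have hDu : HoloUnits (fun p : ℂ × ℂ => D p.1) {p | p.1 ≠ 0} := by
      refine ⟨differentiableOn_matrix_iff.2 fun k j => ?_, fun p hp => ?_⟩
      · by_cases hkj : k = j
        · subst hkj
          by_cases hk : k = i
          · simp only [hD, hk, Matrix.diagonal_apply_eq, if_true]
            exact differentiableOn_fst.inv fun p hp => hp
          · simp [hD, hk]
        · simp [hD, hkj]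
      · rw [Matrix.isUnit_iff_isUnit_det, hDdet]
        exact (inv_ne_zero hp).isUnit
    have hQu : HoloUnits (fun p : ℂ × ℂ => Qe p.2) {p | p.1 ≠ 0} := by
      refine ⟨differentiableOn_matrix_iff.2 fun k j => ?_, fun p _ => hQunit _⟩
      exact ((Q k j).differentiable.comp differentiable_snd).differentiableOn
    refine ⟨fun p => G p * (D p.1 * Qe p.2), fun q => q.2⁻¹ • C q, hG.mul (hDu.mul hQu),
      ⟨?_, fun q hq => ?_⟩, fun q hq hq1 => ?_⟩
    · have h1 : DifferentiableOn ℂ (fun q : ℂ × ℂ => q.2⁻¹) W :=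
        differentiableOn_snd.inv fun q hq => hq.1
      exact h1.smul hC.1
    · exact (hC.2 q hq).smul (Units.mk0 _ (inv_ne_zero hq.1))
    · simp only
      rw [hGC q hq hq1, hM'e q hq hq1, Matrix.mul_smul, smul_smul, inv_mul_cancel₀ hq.1, one_smul]
      simp only [mul_assoc]

end Elementary

section Trivialization
attribute [local instance] Matrix.linftyOpNormedRing Matrix.linftyOpNormedAlgebra
variable {r : ℕ}

lemma exists_factorization_near_punctured_zero_section {T : ℂ × ℂ → Matrix (Fin r) (Fin r) ℂ}
    (hT : HoloUnits T {p | p.1 ≠ 0}) :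
    ∃ (ε : ℝ) (S Γ C : ℂ × ℂ → Matrix (Fin r) (Fin r) ℂ), 0 < ε ∧
      HoloUnits S {p | ‖p.2‖ < ε} ∧ HoloUnits Γ {p | p.1 ≠ 0} ∧
      HoloUnits C {q | q.2 ≠ 0 ∧ ‖q.1‖ < 2 ∧ ‖q.1 * q.2‖ < ε} ∧
      ∀ q : ℂ × ℂ, q.1 ≠ 0 → q.2 ≠ 0 → ‖q.1‖ < 2 → ‖q.1 * q.2‖ < ε →
        T (q.1⁻¹, q.1 * q.2) = S (q.1⁻¹, q.1 * q.2) * Γ (q.1 * q.2, q.2) * C q := by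
  obtain ⟨ε, S, X, N, m, e, hε, hS, hX, he, hXe, hTX⟩ := exists_factorization_near_zero_section hT
  have hX' := differentiableOn_matrix_iff.1 hX
  set W : Set (ℂ × ℂ) := {q | q.2 ≠ 0 ∧ ‖q.1‖ < 2 ∧ ‖q.1 * q.2‖ < ε} with hW
  let M : Matrix (Fin r) (Fin r) (Polynomial (holoRing {p : ℂ × ℂ | ‖p.1‖ < 2 ∧ ‖p.2‖ < ε})) :=
    Matrix.of fun i j => Polynomial.C ⟨fun p => X p i j, hX' i j⟩
  have hM : ∀ q, (blowupEval _ q).mapMatrix M = X (q.1, q.1 * q.2) := fun q => by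
    ext i j
    exact blowupEval_C _ _
  have hblow : ContinuousOn (fun q : ℂ × ℂ => e (q.1, q.1 * q.2)) W :=
    he.comp (f := fun q : ℂ × ℂ => (q.1, q.1 * q.2)) (by fun_prop) fun q hq => hq.2
  obtain ⟨G, C, hG, hC, hGC⟩ := exists_elementary_factorization two_pos hε m M
    (fun q => e (q.1, q.1 * q.2) * (q.2 ^ m)⁻¹)
    (hblow.mul (ContinuousOn.inv₀ (by fun_prop) fun q hq => pow_ne_zero _ hq.1))
    (fun q hq => mul_ne_zero (hXe (q.1, q.1 * q.2) hq.2.1 hq.2.2).1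
      (inv_ne_zero (pow_ne_zero _ hq.1)))
    (fun q hq => by
      have hq2 : q.2 ≠ 0 := hq.1
      rw [hM, (hXe (q.1, q.1 * q.2) hq.2.1 hq.2.2).2, mul_pow]
      field_simp)
  have hpow1 : DifferentiableOn ℂ (fun p : ℂ × ℂ => (p.1 ^ N)⁻¹) {p | p.1 ≠ 0} :=
    (differentiable_fst.pow N).differentiableOn.inv fun p hp => pow_ne_zero _ hp
  have hpow2 : DifferentiableOn ℂ (fun p : ℂ × ℂ => p.2 ^ N) W := by fun_prop
  refine ⟨ε, S, fun p => (p.1 ^ N)⁻¹ • Ring.inverse (G p), fun q => q.2 ^ N • C q, hε, hS,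
    ⟨hpow1.smul hG.inv.1, fun p hp => (hG.inv.2 p hp).smul
      (Units.mk0 _ (inv_ne_zero (pow_ne_zero N hp)))⟩,
    ⟨hpow2.smul hC.1, fun q hq => (hC.2 q hq).smul (Units.mk0 _ (pow_ne_zero N hq.1))⟩, ?_⟩
  intro q h1 h2 h3 h4
  have hq : q ∈ W := ⟨h2, h3, h4⟩
  have hlt : 1 / 2 < ‖q.1⁻¹‖ := by
    rw [norm_inv, one_div]
    exact inv_strictAnti₀ (norm_pos_iff.2 h1) h3
  rw [hTX _ hlt h4]
  simp only [inv_inv]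
  rw [hGC q hq h1, hM, Matrix.mul_smul, Matrix.mul_smul, Matrix.mul_smul, Matrix.smul_mul,
    smul_smul, mul_assoc,
    Ring.inverse_mul_cancel_left _ _ (hG.2 _ (mul_ne_zero h1 h2))]
  congr 1
  rw [mul_pow, inv_pow]
  field_simp

lemma exists_trivialization_punctured {T : ℂ × ℂ → Matrix (Fin r) (Fin r) ℂ}
    (hT : HoloUnits T {p | p.1 ≠ 0}) :
    ∃ A B : ℂ × ℂ → Matrix (Fin r) (Fin r) ℂ, HoloUnits A {p | p.2 ≠ 0} ∧
      HoloUnits B {p | p.2 ≠ 0} ∧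
      ∀ p : ℂ × ℂ, p.1 ≠ 0 → p.2 ≠ 0 → T p = A p * Ring.inverse (B (p.1⁻¹, p.1 * p.2)) := by
  obtain ⟨ε, S, Γ, C, hε, hS, hΓ, hC, hTC⟩ := exists_factorization_near_punctured_zero_section hT
  obtain ⟨F, P, hF, hP, hFP⟩ := exists_splitting (half_pos hε) (half_lt_self hε) hS hΓ
  have hF1 : HoloUnits (fun p : ℂ × ℂ => F (p.2, p.1 * p.2)) {p | p.2 ≠ 0} :=
    hF.comp (φ := fun p : ℂ × ℂ => (p.2, p.1 * p.2)) (by fun_prop) fun p hp => hp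
  have hF2 : HoloUnits (fun q : ℂ × ℂ => F (q.1 * q.2, q.2)) {q | q.1 ≠ 0 ∧ q.2 ≠ 0} :=
    hF.comp (φ := fun q : ℂ × ℂ => (q.1 * q.2, q.2)) (by fun_prop) fun q hq =>
      mul_ne_zero hq.1 hq.2
  have hT2 : HoloUnits (fun q : ℂ × ℂ => T (q.1⁻¹, q.1 * q.2)) {q | q.1 ≠ 0 ∧ q.2 ≠ 0} := by
    have hinv : DifferentiableOn ℂ (fun q : ℂ × ℂ => q.1⁻¹) {q | q.1 ≠ 0 ∧ q.2 ≠ 0} :=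
      differentiableOn_fst.inv fun q hq => hq.1
    exact hT.comp (φ := fun q : ℂ × ℂ => (q.1⁻¹, q.1 * q.2)) (hinv.prodMk (by fun_prop))
      fun q hq => inv_ne_zero hq.1
  have hP2 : HoloUnits (fun q : ℂ × ℂ => P (q.1 * q.2, q.2))
      {q | q.2 ≠ 0 ∧ ‖q.1‖ < 2 ∧ ‖q.1 * q.2‖ < ε / 2} :=
    hP.comp (φ := fun q : ℂ × ℂ => (q.1 * q.2, q.2)) (by fun_prop) fun q hq => hq.2.2
  have hC2 := hC.mono (t := {q | q.2 ≠ 0 ∧ ‖q.1‖ < 2 ∧ ‖q.1 * q.2‖ < ε / 2}) fun q hq =>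
    ⟨hq.1, hq.2.1, hq.2.2.trans (half_lt_self hε)⟩
  obtain ⟨B, hB, -, hB2⟩ := (hP2.inv.mul hC2).exists_glue (hF2.inv.mul hT2)
    ((isOpen_ne_fun continuous_snd continuous_const).inter
      ((isOpen_lt continuous_fst.norm continuous_const).inter
        (isOpen_lt (continuous_fst.mul continuous_snd).norm continuous_const)))
    ((isOpen_ne_fun continuous_fst continuous_const).inter
      (isOpen_ne_fun continuous_snd continuous_const)) (by
      rintro q ⟨hq, hq1, hq2⟩
      have h1 := hTC q hq1 hq2 hq.2.1 (hq.2.2.trans (half_lt_self hε))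
      have h2 := hFP (q.1 * q.2, q.2) (mul_ne_zero hq1 hq2) hq.2.2
      have hx : q.2 / (q.1 * q.2) = q.1⁻¹ := by field_simp
      simp only [hx] at h2
      change Ring.inverse (P (q.1 * q.2, q.2)) * C q =
        Ring.inverse (F (q.1 * q.2, q.2)) * T (q.1⁻¹, q.1 * q.2)
      have hFu := hF2.2 q ⟨hq1, hq2⟩
      have hPu := hP2.2 q hq
      have h3 : T (q.1⁻¹, q.1 * q.2) =
          F (q.1 * q.2, q.2) * (Ring.inverse (P (q.1 * q.2, q.2)) * C q) := by
        rw [h1, h2, ← mul_assoc, Ring.mul_inverse_cancel_right _ _ hPu]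
      rw [h3, Ring.inverse_mul_cancel_left _ _ hFu])
  have hB' : HoloUnits B {q | q.2 ≠ 0} := hB.mono fun q hq => by
    by_cases h : q.1 = 0
    · exact Or.inl ⟨hq, by simp [h], by simpa [h] using hε⟩
    · exact Or.inr ⟨h, hq⟩
  refine ⟨_, _, hF1, hB'.inv, fun p h1 h2 => ?_⟩
  have h3 : ((p.1⁻¹, p.1 * p.2) : ℂ × ℂ) ∈ {q : ℂ × ℂ | q.1 ≠ 0 ∧ q.2 ≠ 0} :=
    ⟨inv_ne_zero h1, mul_ne_zero h1 h2⟩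
  rw [Ring.inverse_inverse (hB'.2 _ h3.2), hB2 h3]
  simp only [inv_inv, inv_mul_cancel_left₀ h1]
  rw [Ring.mul_inverse_cancel_left _ _ (hF1.2 p h2)]

lemma holoGL_iff_holoUnits {A : ℂ × ℂ → Matrix (Fin r) (Fin r) ℂ} {s : Set (ℂ × ℂ)} :
    HoloGL r s A ↔ HoloUnits A s :=
  and_congr_left' differentiableOn_matrix_iff.symm

end Trivialization

end PuncturedTriviality

/-- Every holomorphic vector bundle on
`Z_1 = Tot 𝒪_{ℙ¹}(-1)` restricts to a trivial bundle on the complement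
`Z_1 ∖ ℓ` of the zero section: there are holomorphic trivializing frames `A`
on `U ∖ ℓ = {u ≠ 0}` and `B` on `V ∖ ℓ = {v ≠ 0}` exhibiting the transition
matrix as a coboundary over `Z_1 ∖ ℓ`. -/
theorem statement_2 (r : ℕ) (E : BundleData r 1) :
    ∃ A B : ℂ × ℂ → Matrix (Fin r) (Fin r) ℂ,
      HoloGL r {p | p.2 ≠ 0} A ∧ HoloGL r {p | p.2 ≠ 0} B ∧
      ∀ p : ℂ × ℂ, p.1 ≠ 0 → p.2 ≠ 0 →
        E.T p = A p * (B (coordChange 1 p))⁻¹ := by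
  obtain ⟨A, B, hA, hB, hAB⟩ := exists_trivialization_punctured
    (holoGL_iff_holoUnits.1 ⟨E.holo, E.invertible⟩)
  refine ⟨A, B, holoGL_iff_holoUnits.2 hA, holoGL_iff_holoUnits.2 hB, fun p h1 h2 => ?_⟩
  rw [hAB p h1 h2, Matrix.nonsing_inv_eq_ringInverse, coordChange, pow_one]
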